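/- Let n ≥ 1, κ > 0, let μ0 be a finite nonnegative compactly supported Borel measure on ℝ^n that is absolutely continuous with respect to Lebesgue measure, and let μ1 be a finite nonnegative compactly supported Borel measure on ℝ^n. Then the soft-marginal Hellinger–Kantorovich problem inf_π E_κ(π|μ0,μ1) admits a unique minimizer π, and there exists a Borel map T : ℝ^n → ℝ^n such that π = (id,T)_# π0, where π0 is the first marginal of π and (id,T)_# π0 denotes the pushforward of π0 under x ↦ (x, T(x)). -/

import Mathlib

open MeasureTheory ENNReal Filter Topology RealInnerProductSpace
open scoped Classical

noncomputable section

abbrev Eucl (n : ℕ) : Type := EuclideanSpace ℝ (Fin n)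

/-- Truncated cosine `Cos`. -/
def truncCos (s : ℝ) : ℝ := Real.cos (min |s| (Real.pi / 2))

/-- The Hellinger–Kantorovich cost function `c_κ`. -/
def cHK {n : ℕ} (κ : ℝ) (x y : Eucl n) : ℝ≥0∞ :=
  if dist x y < κ * Real.pi / 2 then
    ENNReal.ofReal (-2 * κ ^ 2 * Real.log (Real.cos (dist x y / κ)))
  else ⊤

/-- Kullback–Leibler divergence `KL(ρ|μ)`. -/
def KLdiv {α : Type*} [MeasurableSpace α] (ρ μ : Measure α) : ℝ≥0∞ :=
  if ρ ≪ μ then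
    ∫⁻ x, ENNReal.ofReal ((ρ.rnDeriv μ x).toReal * Real.log (ρ.rnDeriv μ x).toReal
      - (ρ.rnDeriv μ x).toReal + 1) ∂μ
  else ⊤

/-- The soft-marginal Hellinger–Kantorovich functional `E_κ(π|μ0,μ1)`. -/
def HKfun {n : ℕ} (κ : ℝ) (π : Measure (Eucl n × Eucl n)) (μ0 μ1 : Measure (Eucl n)) : ℝ≥0∞ :=
  ∫⁻ p, cHK κ p.1 p.2 ∂π + ENNReal.ofReal (κ ^ 2) * KLdiv (π.map Prod.fst) μ0
    + ENNReal.ofReal (κ ^ 2) * KLdiv (π.map Prod.snd) μ1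

/-- The squared Hellinger–Kantorovich distance `HK_κ²(μ0,μ1)`. -/
def HK2 {n : ℕ} (κ : ℝ) (μ0 μ1 : Measure (Eucl n)) : ℝ≥0∞ :=
  ⨅ (π : Measure (Eucl n × Eucl n)) (_ : IsFiniteMeasure π), HKfun κ π μ0 μ1

/-- The squared 2-Wasserstein distance `W2²(μ0,μ1)`. -/
def W2sq {n : ℕ} (μ0 μ1 : Measure (Eucl n)) : ℝ≥0∞ :=
  ⨅ (π : Measure (Eucl n × Eucl n))
    (_ : π.map Prod.fst = μ0 ∧ π.map Prod.snd = μ1),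
      ∫⁻ p, ENNReal.ofReal (dist p.1 p.2 ^ 2) ∂π

/-- Narrow convergence of a sequence of measures. -/
def NarrowTendsto {α : Type*} [MeasurableSpace α] [TopologicalSpace α]
    (ρ : ℕ → Measure α) (ρlim : Measure α) : Prop :=
  ∀ φ : BoundedContinuousFunction α ℝ,
    Tendsto (fun N => ∫ x, φ x ∂(ρ N)) atTop (𝓝 (∫ x, φ x ∂ρlim))

/-- The spherical Hellinger–Kantorovich distance `SHK_κ(μ0,μ1)`. -/
def SHK {n : ℕ} (κ : ℝ) (μ0 μ1 : Measure (Eucl n)) : ℝ :=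
  κ * Real.arccos (1 - (HK2 κ μ0 μ1).toReal / (2 * κ ^ 2))

/-- The square-root measure `√(ρσ)`. -/
def sqrtMeasure {α : Type*} [MeasurableSpace α] (ρ σ : Measure α) : Measure α :=
  (ρ + σ).withDensity (fun x => (ρ.rnDeriv (ρ + σ) x * σ.rnDeriv (ρ + σ) x) ^ (1/2 : ℝ))



/-- barycentric HK velocity. -/
def barV {n : ℕ} (κ : ℝ) (μ0 : Measure (Eucl n)) (π : Measure (Eucl n × Eucl n))
    [IsFiniteMeasure π] (x : Eucl n) : Eucl n :=
  (κ * ((π.map Prod.fst).rnDeriv μ0 x).toReal) •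
    ∫ y, (Real.tan (‖y - x‖ / κ) / ‖y - x‖) • (y - x) ∂(π.condKernel x)

/-- barycentric HK growth. -/
def barA {n : ℕ} (μ0 : Measure (Eucl n)) (π : Measure (Eucl n × Eucl n)) (x : Eucl n) : ℝ :=
  2 * (((π.map Prod.fst).rnDeriv μ0 x).toReal - 1)

/-- barycentric W2 velocity. -/
def barW {n : ℕ} (π : Measure (Eucl n × Eucl n)) [IsFiniteMeasure π] (x : Eucl n) : Eucl n :=
  ∫ y, (y - x) ∂(π.condKernel x)

end

section

open InformationTheory (klFun)

/-- Tangent line inequality for `klFun` with a Hellinger remainder. -/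
theorem klFun_add_sq_le {s m : ℝ} (hs : 0 ≤ s) (hm : 0 < m) :
    klFun m + (s - m) * Real.log m + (√s - √m) ^ 2 ≤ klFun s := by
  obtain ⟨r, hr, rfl⟩ : ∃ r, 0 ≤ r ∧ s = r ^ 2 * m :=
    ⟨√(s / m), Real.sqrt_nonneg _, by rw [Real.sq_sqrt (by positivity)]; field_simp⟩
  have h1 : √(r ^ 2 * m) = r * √m := by
    rw [Real.sqrt_mul (by positivity), Real.sqrt_sq hr]
  have h2 : (√m) ^ 2 = m := Real.sq_sqrt hm.le
  have h3 : (r * √m - √m) ^ 2 = (r - 1) ^ 2 * m := by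
    rw [← sub_one_mul, mul_pow, h2]
  rw [h1, h3]
  simp only [InformationTheory.klFun_apply]
  have h4 := InformationTheory.klFun_nonneg hr
  rw [InformationTheory.klFun_apply] at h4
  rcases hr.eq_or_lt with rfl | hr
  · simp; linarith
  rw [Real.log_mul (by positivity) hm.ne', Real.log_pow]
  have h5 : 0 ≤ 2 * (r * m) * (r * Real.log r + 1 - r) := by positivity
  push_cast
  nlinarith

theorem two_mul_klFun_midpoint_le {s t : ℝ} (hs : 0 ≤ s) (ht : 0 ≤ t) :
    2 * klFun ((s + t) / 2) + (√s - √t) ^ 2 / 2 ≤ klFun s + klFun t := by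
  rcases (add_nonneg hs ht).eq_or_lt with h | h
  · obtain rfl : s = 0 := by linarith
    obtain rfl : t = 0 := by linarith
    simp only [add_zero, zero_div, sub_self]; norm_num; linarith
  · have h1 := klFun_add_sq_le hs (half_pos h)
    have h2 := klFun_add_sq_le ht (half_pos h)
    nlinarith [sq_nonneg (√s + √t - 2 * √((s + t) / 2))]

theorem le_two_mul_klFun_add {s : ℝ} (hs : 0 ≤ s) : s ≤ 2 * (klFun s + 1) := by
  have := klFun_add_sq_le hs one_pos
  simp only [InformationTheory.klFun_one, Real.log_one, Real.sqrt_one] at this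
  nlinarith [Real.sq_sqrt hs, sq_nonneg (√s - 2)]

theorem abs_sub_le_hellinger {s t η : ℝ} (hs : 0 ≤ s) (ht : 0 ≤ t) (hη : 0 < η) :
    |s - t| ≤ η⁻¹ * (√s - √t) ^ 2 + η * (s + t) := by
  have h1 : s - t = (√s - √t) * (√s + √t) := by
    nlinarith [Real.sq_sqrt hs, Real.sq_sqrt ht]
  have h2 : |√s - √t| * (√s + √t) ≤ η⁻¹ * (√s - √t) ^ 2 + η * (√s + √t) ^ 2 / 2 := by
    rw [← sq_abs (√s - √t)]
    set a := |√s - √t|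
    set b := √s + √t
    have : 0 ≤ η⁻¹ * ((a - η * b) ^ 2 + a ^ 2) := by positivity
    have e : η⁻¹ * ((a - η * b) ^ 2 + a ^ 2) = 2 * (η⁻¹ * a ^ 2) - 2 * (a * b) + η * b ^ 2 := by
      field_simp; ring
    linarith
  rw [h1, abs_mul, abs_of_nonneg (by positivity : 0 ≤ √s + √t)]
  refine h2.trans ?_
  have h3 : (√s + √t) ^ 2 ≤ 2 * (s + t) := by
    nlinarith [Real.sq_sqrt hs, Real.sq_sqrt ht, sq_nonneg (√s - √t)]
  nlinarith

/-- First-order upper bound for `klFun` when part of the mass is removed. -/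
theorem klFun_remove_le {a b ε : ℝ} (ha : 0 ≤ a) (hb : 0 ≤ b) (hε : 0 < ε) (hε1 : ε < 1) :
    klFun ((1 - ε) * a + b) ≤ klFun (a + b) + -ε * (a * Real.log ((1 - ε) * (a + b))) := by
  have h1 : 0 < 1 - ε := by linarith
  rcases (add_nonneg ha hb).eq_or_lt with h | h
  · obtain rfl : a = 0 := by linarith
    obtain rfl : b = 0 := by linarith
    simp
  · have h2 : (1 - ε) * (a + b) ≤ (1 - ε) * a + b := by nlinarith
    have h3 : 0 < (1 - ε) * (a + b) := by positivity
    have h4 := klFun_add_sq_le (add_nonneg ha hb) (h3.trans_le h2)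
    have h5 := Real.log_le_log h3 h2
    have h6 := mul_le_mul_of_nonneg_left h5 (mul_nonneg hε.le ha)
    nlinarith [sq_nonneg (√(a + b) - √((1 - ε) * a + b))]

/-- First-order upper bound for `klFun` when mass is added. -/
theorem klFun_add_le {s a ε δ : ℝ} (hs : 0 ≤ s) (ha : 0 ≤ a) (hε : 0 < ε) (h : ε * a ≤ δ) :
    klFun (s + ε * a) ≤ klFun s + ε * (a * Real.log (s + δ)) := by
  have hea : 0 ≤ ε * a := by positivity
  rcases (add_nonneg hs hea).eq_or_lt with h0 | h0
  · have h1 : ε * a = 0 := by linarith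
    rw [← mul_assoc, h1]; simp
  · have h4 := klFun_add_sq_le hs h0
    have h5 := Real.log_le_log h0 (by linarith : s + ε * a ≤ s + δ)
    have h6 := mul_le_mul_of_nonneg_left h5 hea
    nlinarith [sq_nonneg (√s - √(s + ε * a))]

section Density

variable {α : Type*} [MeasurableSpace α]

/-- Real-valued Radon–Nikodym density. -/
noncomputable def dens (ρ μ : Measure α) (x : α) : ℝ := (ρ.rnDeriv μ x).toReal

theorem dens_nonneg (ρ μ : Measure α) (x : α) : 0 ≤ dens ρ μ x := toReal_nonneg

theorem measurable_dens (ρ μ : Measure α) : Measurable (dens ρ μ) :=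
  (Measure.measurable_rnDeriv ρ μ).ennreal_toReal

theorem KLdiv_of_ac {ρ μ : Measure α} (h : ρ ≪ μ) :
    KLdiv ρ μ = ∫⁻ x, ENNReal.ofReal (klFun (dens ρ μ x)) ∂μ := by
  rw [KLdiv, if_pos h]
  congr 1 with x
  simp only [dens, InformationTheory.klFun_apply]
  congr 1; ring

theorem ac_of_KLdiv_ne_top {ρ μ : Measure α} (h : KLdiv ρ μ ≠ ⊤) : ρ ≪ μ := by
  by_contra h'
  exact h (if_neg h')

theorem measurable_ofReal_klFun_dens (ρ μ : Measure α) :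
    Measurable fun x => ENNReal.ofReal (klFun (dens ρ μ x)) :=
  (InformationTheory.measurable_klFun.comp (measurable_dens ρ μ)).ennreal_ofReal

theorem integrable_dens (ρ μ : Measure α) [IsFiniteMeasure ρ] : Integrable (dens ρ μ) μ :=
  Measure.integrable_toReal_rnDeriv

theorem dens_pos_ae {ρ μ : Measure α} [IsFiniteMeasure ρ] [IsFiniteMeasure μ] (h : ρ ≪ μ) :
    ∀ᵐ x ∂ρ, 0 < dens ρ μ x := by
  filter_upwards [Measure.rnDeriv_pos h, h.ae_le (Measure.rnDeriv_lt_top ρ μ)] with x h1 h2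
  exact toReal_pos h1.ne' h2.ne

theorem dens_smul_add {ρ ρ' μ : Measure α} [IsFiniteMeasure ρ] [IsFiniteMeasure ρ']
    [IsFiniteMeasure μ] (r r' : NNReal) :
    ∀ᵐ x ∂μ, dens (r • ρ + r' • ρ') μ x = r * dens ρ μ x + r' * dens ρ' μ x := by
  filter_upwards [Measure.rnDeriv_add' (r • ρ) (r' • ρ') μ, Measure.rnDeriv_smul_left' ρ μ r,
    Measure.rnDeriv_smul_left' ρ' μ r', Measure.rnDeriv_lt_top ρ μ, Measure.rnDeriv_lt_top ρ' μ]
    with x h1 h2 h3 h4 h5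
  have e : (r • ρ + r' • ρ').rnDeriv μ x = r * ρ.rnDeriv μ x + r' * ρ'.rnDeriv μ x := by
    rw [h1, Pi.add_apply, h2, h3]; rfl
  simp only [dens, e]
  rw [toReal_add (mul_ne_top coe_ne_top h4.ne) (mul_ne_top coe_ne_top h5.ne), toReal_mul,
    toReal_mul]
  rfl

theorem ofReal_dens_withDensity {ρ μ : Measure α} [IsFiniteMeasure ρ] [IsFiniteMeasure μ]
    (h : ρ ≪ μ) : μ.withDensity (fun x => ENNReal.ofReal (dens ρ μ x)) = ρ := by
  rw [← Measure.withDensity_rnDeriv_eq ρ μ h]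
  refine withDensity_congr_ae ?_
  rw [Measure.withDensity_rnDeriv_eq ρ μ h]
  filter_upwards [Measure.rnDeriv_lt_top ρ μ] with x hx
  exact ofReal_toReal hx.ne

theorem eq_of_dens_ae_eq {ρ ρ' μ : Measure α} [IsFiniteMeasure ρ] [IsFiniteMeasure ρ']
    [IsFiniteMeasure μ] (h : ρ ≪ μ) (h' : ρ' ≪ μ) (e : dens ρ μ =ᵐ[μ] dens ρ' μ) : ρ = ρ' := by
  rw [← ofReal_dens_withDensity h, ← ofReal_dens_withDensity h']
  exact withDensity_congr_ae (e.mono fun x hx => by simp only [hx])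

/-- Squared Hellinger defect between two densities. -/
noncomputable def hell (ρ ρ' μ : Measure α) : ℝ≥0∞ :=
  ∫⁻ x, ENNReal.ofReal ((√(dens ρ μ x) - √(dens ρ' μ x)) ^ 2 / 2) ∂μ

theorem KLdiv_midpoint {ρ ρ' μ : Measure α} [IsFiniteMeasure ρ] [IsFiniteMeasure ρ']
    [IsFiniteMeasure μ] :
    2 * KLdiv ((2⁻¹ : NNReal) • ρ + (2⁻¹ : NNReal) • ρ') μ + hell ρ ρ' μ
      ≤ KLdiv ρ μ + KLdiv ρ' μ := by
  by_cases hρ : KLdiv ρ μ = ⊤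
  · simp [hρ]
  by_cases hρ' : KLdiv ρ' μ = ⊤
  · simp [hρ']
  have h := ac_of_KLdiv_ne_top hρ
  have h' := ac_of_KLdiv_ne_top hρ'
  have hm : (2⁻¹ : NNReal) • ρ + (2⁻¹ : NNReal) • ρ' ≪ μ :=
    (h.smul_left _).add_left (h'.smul_left _)
  rw [KLdiv_of_ac h, KLdiv_of_ac h', KLdiv_of_ac hm, hell,
    ← lintegral_const_mul _ (measurable_ofReal_klFun_dens _ _),
    ← lintegral_add_left ((measurable_ofReal_klFun_dens _ _).const_mul _),
    ← lintegral_add_left (measurable_ofReal_klFun_dens _ _)]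
  refine lintegral_mono_ae ?_
  filter_upwards [dens_smul_add (ρ := ρ) (ρ' := ρ') (μ := μ) 2⁻¹ 2⁻¹] with x hx
  have n1 := dens_nonneg ρ μ x
  have n2 := dens_nonneg ρ' μ x
  have e : ((2⁻¹ : NNReal) : ℝ) * dens ρ μ x + ((2⁻¹ : NNReal) : ℝ) * dens ρ' μ x
      = (dens ρ μ x + dens ρ' μ x) / 2 := by push_cast; ring
  have k0 := InformationTheory.klFun_nonneg (by positivity : 0 ≤ (dens ρ μ x + dens ρ' μ x) / 2)
  rw [hx, e, ← ofReal_add (InformationTheory.klFun_nonneg n1) (InformationTheory.klFun_nonneg n2)]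
  have e2 : (2 : ℝ≥0∞) = ENNReal.ofReal 2 := by simp
  rw [e2, ← ofReal_mul (by norm_num), ← ofReal_add (by positivity) (by positivity)]
  exact ofReal_le_ofReal (two_mul_klFun_midpoint_le n1 n2)

theorem dens_ae_eq_of_hell_eq_zero {ρ ρ' μ : Measure α} (h : hell ρ ρ' μ = 0) :
    dens ρ μ =ᵐ[μ] dens ρ' μ := by
  have hm : Measurable fun x => ENNReal.ofReal ((√(dens ρ μ x) - √(dens ρ' μ x)) ^ 2 / 2) := by
    have := measurable_dens ρ μ
    have := measurable_dens ρ' μ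
    fun_prop
  rw [hell, lintegral_eq_zero_iff hm] at h
  filter_upwards [h] with x hx
  simp only [Pi.zero_apply, ofReal_eq_zero] at hx
  have h0 : √(dens ρ μ x) = √(dens ρ' μ x) := by
    nlinarith [sq_nonneg (√(dens ρ μ x) - √(dens ρ' μ x))]
  exact (Real.sqrt_inj (dens_nonneg _ _ _) (dens_nonneg _ _ _)).1 h0

/-- Real-valued form of the divergence. -/
theorem integrable_klFun_dens {ρ μ : Measure α} (h : KLdiv ρ μ ≠ ⊤) :
    Integrable (fun x => klFun (dens ρ μ x)) μ ∧
      (KLdiv ρ μ).toReal = ∫ x, klFun (dens ρ μ x) ∂μ := by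
  have hm : Measurable (fun x => klFun (dens ρ μ x)) :=
    InformationTheory.measurable_klFun.comp (measurable_dens ρ μ)
  have hn : 0 ≤ᵐ[μ] fun x => klFun (dens ρ μ x) :=
    ae_of_all _ fun x => InformationTheory.klFun_nonneg (dens_nonneg _ _ _)
  have hac := ac_of_KLdiv_ne_top h
  rw [KLdiv_of_ac hac] at h ⊢
  refine ⟨(lintegral_ofReal_ne_top_iff_integrable hm.aestronglyMeasurable hn).1 h, ?_⟩
  rw [integral_eq_lintegral_of_nonneg_ae hn hm.aestronglyMeasurable]

theorem KLdiv_le_add {ρ ρ' μ : Measure α} (h : KLdiv ρ μ ≠ ⊤) (h' : ρ' ≪ μ) {u : α → ℝ}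
    (hu : Integrable u μ) (hle : ∀ᵐ x ∂μ, klFun (dens ρ' μ x) ≤ klFun (dens ρ μ x) + u x) :
    KLdiv ρ' μ ≠ ⊤ ∧ (KLdiv ρ' μ).toReal ≤ (KLdiv ρ μ).toReal + ∫ x, u x ∂μ := by
  obtain ⟨hi, he⟩ := integrable_klFun_dens h
  have hm : Measurable (fun x => klFun (dens ρ' μ x)) :=
    InformationTheory.measurable_klFun.comp (measurable_dens ρ' μ)
  have hn : 0 ≤ᵐ[μ] fun x => klFun (dens ρ' μ x) :=
    ae_of_all _ fun x => InformationTheory.klFun_nonneg (dens_nonneg _ _ _)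
  have hi' : Integrable (fun x => klFun (dens ρ' μ x)) μ := by
    refine (hi.add hu).mono' hm.aestronglyMeasurable ?_
    filter_upwards [hle, hn] with x h1 h2
    rwa [Real.norm_of_nonneg h2]
  have ht : KLdiv ρ' μ ≠ ⊤ := by
    rw [KLdiv_of_ac h']
    exact (lintegral_ofReal_ne_top_iff_integrable hm.aestronglyMeasurable hn).2 hi'
  refine ⟨ht, ?_⟩
  rw [(integrable_klFun_dens ht).2, he, ← integral_add hi hu]
  exact integral_mono_ae hi' (hi.add hu) hle

end Density

section Cost

variable {n : ℕ} {κ : ℝ}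

/-- The kernel `Cos(|x-y|/κ)` associated with the cost. -/
noncomputable def cosKer (κ : ℝ) (x y : Eucl n) : ℝ := truncCos (dist x y / κ)

theorem truncCos_nonneg (s : ℝ) : 0 ≤ truncCos s :=
  Real.cos_nonneg_of_neg_pi_div_two_le_of_le
    ((neg_nonpos.2 (by positivity)).trans (le_min (abs_nonneg s) (by positivity)))
    (min_le_right _ _)

theorem cosKer_nonneg (x y : Eucl n) : 0 ≤ cosKer κ x y := truncCos_nonneg _

theorem cosKer_le_one (x y : Eucl n) : cosKer κ x y ≤ 1 := Real.cos_le_one _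

theorem cosKer_of_lt (hκ : 0 < κ) {x y : Eucl n} (h : dist x y < κ * Real.pi / 2) :
    cosKer κ x y = Real.cos (dist x y / κ) := by
  have h0 : 0 ≤ dist x y / κ := by positivity
  have h1 : dist x y / κ < Real.pi / 2 := by
    rw [div_lt_iff₀ hκ]; linarith
  rw [cosKer, truncCos, abs_of_nonneg h0, min_eq_left h1.le]

theorem cosKer_pos_iff (hκ : 0 < κ) {x y : Eucl n} :
    0 < cosKer κ x y ↔ dist x y < κ * Real.pi / 2 := by
  have h0 : 0 ≤ dist x y / κ := by positivity
  constructor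
  · intro h
    by_contra! h'
    have h1 : Real.pi / 2 ≤ dist x y / κ := by
      rw [le_div_iff₀ hκ]; linarith
    rw [cosKer, truncCos, abs_of_nonneg h0, min_eq_right h1, Real.cos_pi_div_two] at h
    exact h.false
  · intro h
    rw [cosKer_of_lt hκ h]
    refine Real.cos_pos_of_mem_Ioo ⟨by linarith [Real.pi_pos], ?_⟩
    rw [div_lt_iff₀ hκ]; linarith

theorem cHK_eq (hκ : 0 < κ) (x y : Eucl n) :
    cHK κ x y = if 0 < cosKer κ x y then
      ENNReal.ofReal (-2 * κ ^ 2 * Real.log (cosKer κ x y)) else ⊤ := by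
  by_cases h : dist x y < κ * Real.pi / 2
  · rw [cHK, if_pos h, if_pos ((cosKer_pos_iff hκ).2 h), cosKer_of_lt hκ h]
  · rw [cHK, if_neg h, if_neg (mt (cosKer_pos_iff hκ).1 h)]

theorem lipschitzWith_truncCos : LipschitzWith 1 truncCos := by
  have h : LipschitzWith 1 fun s : ℝ => min |s| (Real.pi / 2) :=
    lipschitzWith_one_norm.min_const _
  have := Real.lipschitzWith_cos.comp h
  rwa [one_mul] at this

theorem cosKer_sub_le (hκ : 0 < κ) (x x' y : Eucl n) :
    cosKer κ x y - cosKer κ x' y ≤ κ⁻¹ * dist x x' := by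
  have h := lipschitzWith_truncCos.dist_le_mul (dist x y / κ) (dist x' y / κ)
  rw [NNReal.coe_one, one_mul, Real.dist_eq, Real.dist_eq, ← sub_div, abs_div, abs_of_pos hκ] at h
  have h2 : |dist x y - dist x' y| ≤ dist x x' := abs_dist_sub_le x x' y
  calc cosKer κ x y - cosKer κ x' y ≤ |cosKer κ x y - cosKer κ x' y| := le_abs_self _
    _ ≤ |dist x y - dist x' y| / κ := h
    _ ≤ dist x x' / κ := by gcongr
    _ = κ⁻¹ * dist x x' := by rw [div_eq_inv_mul]

theorem continuous_cosKer : Continuous fun p : Eucl n × Eucl n => cosKer κ p.1 p.2 :=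
  lipschitzWith_truncCos.continuous.comp (continuous_dist.div_const κ)

theorem measurable_cHK : Measurable fun p : Eucl n × Eucl n => cHK κ p.1 p.2 := by
  unfold cHK
  refine Measurable.ite (measurableSet_lt measurable_dist measurable_const) ?_ measurable_const
  have : Measurable fun p : Eucl n × Eucl n => dist p.1 p.2 := measurable_dist
  fun_prop

theorem toReal_cHK (hκ : 0 < κ) {x y : Eucl n} (h : 0 < cosKer κ x y) :
    (cHK κ x y).toReal = -2 * κ ^ 2 * Real.log (cosKer κ x y) := by
  rw [cHK_eq hκ, if_pos h, toReal_ofReal]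
  have := Real.log_nonpos h.le (cosKer_le_one x y)
  nlinarith [mul_nonneg (sq_nonneg κ) (neg_nonneg.2 this)]

variable {π π' : Measure (Eucl n × Eucl n)} {μ0 μ1 : Measure (Eucl n)}

theorem HKfun_midpoint [IsFiniteMeasure π] [IsFiniteMeasure π'] [IsFiniteMeasure μ0]
    [IsFiniteMeasure μ1] :
    2 * HKfun κ ((2⁻¹ : NNReal) • π + (2⁻¹ : NNReal) • π') μ0 μ1
      + ENNReal.ofReal (κ ^ 2) * hell (π.map Prod.fst) (π'.map Prod.fst) μ0
      + ENNReal.ofReal (κ ^ 2) * hell (π.map Prod.snd) (π'.map Prod.snd) μ1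
      ≤ HKfun κ π μ0 μ1 + HKfun κ π' μ0 μ1 := by
  have k0 := KLdiv_midpoint (ρ := π.map Prod.fst) (ρ' := π'.map Prod.fst) (μ := μ0)
  have k1 := KLdiv_midpoint (ρ := π.map Prod.snd) (ρ' := π'.map Prod.snd) (μ := μ1)
  simp only [HKfun]
  rw [Measure.map_add _ _ measurable_fst, Measure.map_add _ _ measurable_snd,
    Measure.map_smul, Measure.map_smul, Measure.map_smul, Measure.map_smul, lintegral_add_measure,
    lintegral_smul_measure, lintegral_smul_measure]
  set c := ENNReal.ofReal (κ ^ 2)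
  set A := ∫⁻ p, cHK κ p.1 p.2 ∂π
  set A' := ∫⁻ p, cHK κ p.1 p.2 ∂π'
  have hA : 2 * ((2⁻¹ : NNReal) • A + (2⁻¹ : NNReal) • A') = A + A' := by
    rw [← smul_add, ENNReal.smul_def, smul_eq_mul, ← mul_assoc]
    rw [ENNReal.coe_inv two_ne_zero, ENNReal.coe_ofNat,
      ENNReal.mul_inv_cancel two_ne_zero ofNat_ne_top, one_mul]
  calc _ = 2 * ((2⁻¹ : NNReal) • A + (2⁻¹ : NNReal) • A')
        + c * (2 * KLdiv ((2⁻¹ : NNReal) • π.map Prod.fst + (2⁻¹ : NNReal) • π'.map Prod.fst) μ0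
          + hell (π.map Prod.fst) (π'.map Prod.fst) μ0)
        + c * (2 * KLdiv ((2⁻¹ : NNReal) • π.map Prod.snd + (2⁻¹ : NNReal) • π'.map Prod.snd) μ1
          + hell (π.map Prod.snd) (π'.map Prod.snd) μ1) := by ring
    _ ≤ A + A' + c * (KLdiv (π.map Prod.fst) μ0 + KLdiv (π'.map Prod.fst) μ0)
        + c * (KLdiv (π.map Prod.snd) μ1 + KLdiv (π'.map Prod.snd) μ1) := by
      rw [hA]; gcongr
    _ = _ := by ring

theorem HK2_le [IsFiniteMeasure π] : HK2 κ μ0 μ1 ≤ HKfun κ π μ0 μ1 :=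
  iInf₂_le π ‹_›

theorem HK2_ne_top [IsFiniteMeasure μ0] [IsFiniteMeasure μ1] : HK2 κ μ0 μ1 ≠ ⊤ := by
  refine ne_top_of_le_ne_top ?_ (HK2_le (π := 0))
  have h (μ : Measure (Eucl n)) [IsFiniteMeasure μ] : KLdiv 0 μ ≠ ⊤ := by
    rw [KLdiv_of_ac (Measure.AbsolutelyContinuous.zero μ)]
    have : ∀ᵐ x ∂μ, ENNReal.ofReal (klFun (dens 0 μ x)) = 1 := by
      filter_upwards [Measure.rnDeriv_zero μ] with x hx
      simp [dens, hx, InformationTheory.klFun_zero]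
    rw [lintegral_congr_ae this]
    simp
  simp only [HKfun, Measure.map_zero, lintegral_zero_measure, zero_add]
  exact add_ne_top.2 ⟨mul_ne_top ofReal_ne_top (h _), mul_ne_top ofReal_ne_top (h _)⟩

theorem HKfun_ne_top (hκ : 0 < κ) (h : HKfun κ π μ0 μ1 ≠ ⊤) :
    ∫⁻ p, cHK κ p.1 p.2 ∂π ≠ ⊤ ∧ KLdiv (π.map Prod.fst) μ0 ≠ ⊤ ∧ KLdiv (π.map Prod.snd) μ1 ≠ ⊤ := by
  have hc : ENNReal.ofReal (κ ^ 2) ≠ 0 := by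
    rw [Ne, ofReal_eq_zero, not_le]; positivity
  simp only [HKfun, Ne, add_eq_top, not_or] at h
  refine ⟨h.1.1, fun h' => h.1.2 ?_, fun h' => h.2 ?_⟩
  · rw [h', mul_top hc]
  · rw [h', mul_top hc]

/-- First variation of the functional at a minimizer `π` in direction `t • γ`. -/
theorem first_variation_nonneg (hκ : 0 < κ) (hfin : HKfun κ π μ0 μ1 ≠ ⊤)
    (hle : HKfun κ π μ0 μ1 ≤ HKfun κ π' μ0 μ1)
    {γ : Measure (Eucl n × Eucl n)} [IsFiniteMeasure γ] [IsFiniteMeasure μ0] [IsFiniteMeasure μ1]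
    {t : ℝ} {f0 f1 : Eucl n → ℝ} (hf0m : Measurable f0) (hf1m : Measurable f1)
    (hγ0 : γ.map Prod.fst ≪ μ0) (hγ1 : γ.map Prod.snd ≪ μ1)
    (hf0 : Integrable (fun p => f0 p.1) γ) (hf1 : Integrable (fun p => f1 p.2) γ)
    (hc : Integrable (fun p => (cHK κ p.1 p.2).toReal) γ)
    (h0 : π'.map Prod.fst ≪ μ0) (h1 : π'.map Prod.snd ≪ μ1)
    (hk0 : ∀ᵐ x ∂μ0, klFun (dens (π'.map Prod.fst) μ0 x) ≤
      klFun (dens (π.map Prod.fst) μ0 x) + t * (dens (γ.map Prod.fst) μ0 x * f0 x))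
    (hk1 : ∀ᵐ x ∂μ1, klFun (dens (π'.map Prod.snd) μ1 x) ≤
      klFun (dens (π.map Prod.snd) μ1 x) + t * (dens (γ.map Prod.snd) μ1 x * f1 x))
    (hcπ : ∫⁻ p, cHK κ p.1 p.2 ∂π' ≠ ⊤)
    (hct : (∫⁻ p, cHK κ p.1 p.2 ∂π').toReal ≤
      (∫⁻ p, cHK κ p.1 p.2 ∂π).toReal + t * ∫ p, (cHK κ p.1 p.2).toReal ∂γ) :
    0 ≤ t * ∫ p, ((cHK κ p.1 p.2).toReal + κ ^ 2 * f0 p.1 + κ ^ 2 * f1 p.2) ∂γ := by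
  obtain ⟨g, g0, g1⟩ := HKfun_ne_top hκ hfin
  have key (μ : Measure (Eucl n)) [IsFiniteMeasure μ] (q : Eucl n × Eucl n → Eucl n)
      (hq : Measurable q) (f : Eucl n → ℝ) (hfm : Measurable f) (hγ : γ.map q ≪ μ)
      (hf : Integrable (fun p => f (q p)) γ) :
      Integrable (fun x => t * (dens (γ.map q) μ x * f x)) μ ∧
        ∫ x, t * (dens (γ.map q) μ x * f x) ∂μ = t * ∫ p, f (q p) ∂γ := by
    have hi : Integrable f (γ.map q) := by
      rw [integrable_map_measure hfm.aestronglyMeasurable hq.aemeasurable]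
      exact hf
    refine ⟨((integrable_rnDeriv_smul_iff hγ).2 hi).const_mul t, ?_⟩
    rw [integral_const_mul, ← integral_map hq.aemeasurable hfm.aestronglyMeasurable]
    exact congrArg _ (integral_rnDeriv_smul hγ)
  obtain ⟨i0, e0⟩ := key μ0 _ measurable_fst f0 hf0m hγ0 hf0
  obtain ⟨i1, e1⟩ := key μ1 _ measurable_snd f1 hf1m hγ1 hf1
  obtain ⟨n0, l0⟩ := KLdiv_le_add g0 h0 i0 hk0
  obtain ⟨n1, l1⟩ := KLdiv_le_add g1 h1 i1 hk1
  rw [e0] at l0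
  rw [e1] at l1
  have fin' : HKfun κ π' μ0 μ1 ≠ ⊤ :=
    add_ne_top.2 ⟨add_ne_top.2 ⟨hcπ, mul_ne_top ofReal_ne_top n0⟩, mul_ne_top ofReal_ne_top n1⟩
  have hr := toReal_mono fin' hle
  have hκ2 : 0 ≤ κ ^ 2 := sq_nonneg κ
  have ex (ν : Measure (Eucl n × Eucl n)) (a : ∫⁻ p, cHK κ p.1 p.2 ∂ν ≠ ⊤)
      (a0 : KLdiv (ν.map Prod.fst) μ0 ≠ ⊤) (a1 : KLdiv (ν.map Prod.snd) μ1 ≠ ⊤) :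
      (HKfun κ ν μ0 μ1).toReal = (∫⁻ p, cHK κ p.1 p.2 ∂ν).toReal +
        κ ^ 2 * (KLdiv (ν.map Prod.fst) μ0).toReal +
        κ ^ 2 * (KLdiv (ν.map Prod.snd) μ1).toReal := by
    rw [HKfun, toReal_add (add_ne_top.2 ⟨a, mul_ne_top ofReal_ne_top a0⟩)
      (mul_ne_top ofReal_ne_top a1), toReal_add a (mul_ne_top ofReal_ne_top a0), toReal_mul,
      toReal_mul, toReal_ofReal hκ2]
  rw [ex π g g0 g1, ex π' hcπ n0 n1] at hr
  have hc0 : Integrable (fun p => (cHK κ p.1 p.2).toReal + κ ^ 2 * f0 p.1) γ :=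
    hc.add (hf0.const_mul _)
  rw [integral_add hc0 (hf1.const_mul _), integral_add hc (hf0.const_mul _),
    integral_const_mul, integral_const_mul]
  nlinarith [mul_le_mul_of_nonneg_left l0 hκ2, mul_le_mul_of_nonneg_left l1 hκ2]

end Cost

theorem integrable_log_of_mem_Icc {β : Type*} [MeasurableSpace β] {γ : Measure β}
    [IsFiniteMeasure γ] {F : β → ℝ} (hF : Measurable F) {a b : ℝ} (ha : 0 < a)
    (h : ∀ᵐ p ∂γ, F p ∈ Set.Icc a b) : Integrable (fun p => Real.log (F p)) γ := by
  refine Integrable.of_mem_Icc (Real.log a) (Real.log b)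
    (Real.measurable_log.comp hF).aemeasurable ?_
  filter_upwards [h] with p hp
  exact ⟨Real.log_le_log ha hp.1, Real.log_le_log (ha.trans_le hp.1) hp.2⟩

theorem measure_eq_zero_of_integral_nonpos {β : Type*} [MeasurableSpace β] {γ : Measure β}
    {h : β → ℝ} (hi : Integrable h γ) (hpos : ∀ᵐ p ∂γ, 0 < h p) (hle : ∫ p, h p ∂γ ≤ 0) :
    γ = 0 := by
  have h0 : 0 ≤ᵐ[γ] h := hpos.mono fun p hp => hp.le
  have h1 := (integral_eq_zero_iff_of_nonneg_ae h0 hi).1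
    (le_antisymm hle (integral_nonneg_of_ae h0))
  have h2 : ∀ᵐ p ∂γ, False := by
    filter_upwards [hpos, h1] with p hp1 hp2
    rw [hp2] at hp1
    exact hp1.false
  rw [ae_iff] at h2
  exact Measure.measure_univ_eq_zero.1 (by simpa using h2)

section Optimality

variable {n : ℕ} {κ : ℝ} {π : Measure (Eucl n × Eucl n)} {μ0 μ1 : Measure (Eucl n)}

theorem cosKer_pos_ae (hκ : 0 < κ) (hfin : HKfun κ π μ0 μ1 ≠ ⊤) :
    ∀ᵐ p ∂π, 0 < cosKer κ p.1 p.2 := by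
  filter_upwards [ae_lt_top measurable_cHK (HKfun_ne_top hκ hfin).1] with p hp
  by_contra h
  rw [cHK_eq hκ, if_neg h] at hp
  exact hp.false

theorem measurable_cosKer : Measurable fun p : Eucl n × Eucl n => cosKer κ p.1 p.2 :=
  continuous_cosKer.measurable

theorem cost_add_logs (hκ : 0 < κ) {x y : Eucl n} (h : 0 < cosKer κ x y) {a b : ℝ} (ha : 0 < a)
    (hb : 0 < b) :
    (cHK κ x y).toReal + κ ^ 2 * Real.log a + κ ^ 2 * Real.log b
      = κ ^ 2 * (Real.log (a * b) - Real.log (cosKer κ x y ^ 2)) := by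
  rw [toReal_cHK hκ h, Real.log_mul ha.ne' hb.ne', Real.log_pow]
  push_cast
  ring

theorem integrable_cost (hκ : 0 < κ) {γ : Measure (Eucl n × Eucl n)} [IsFiniteMeasure γ] {a : ℝ}
    (ha : 0 < a) (h : ∀ᵐ p ∂γ, a ≤ cosKer κ p.1 p.2) :
    Integrable (fun p => (cHK κ p.1 p.2).toReal) γ := by
  refine ((integrable_log_of_mem_Icc measurable_cosKer ha
    (h.mono fun p hp => ⟨hp, cosKer_le_one p.1 p.2⟩)).const_mul (-2 * κ ^ 2)).congr ?_
  filter_upwards [h] with p hp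
  rw [toReal_cHK hκ (ha.trans_le hp)]

theorem lintegral_cost_ne_top (hκ : 0 < κ) {γ : Measure (Eucl n × Eucl n)}
    (h : ∀ᵐ p ∂γ, 0 < cosKer κ p.1 p.2)
    (hi : Integrable (fun p => (cHK κ p.1 p.2).toReal) γ) :
    ∫⁻ p, cHK κ p.1 p.2 ∂γ = ENNReal.ofReal (∫ p, (cHK κ p.1 p.2).toReal ∂γ) := by
  rw [ofReal_integral_eq_lintegral_ofReal hi (ae_of_all _ fun p => toReal_nonneg)]
  refine lintegral_congr_ae ?_
  filter_upwards [h] with p hp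
  rw [ofReal_toReal]
  rw [cHK_eq hκ, if_pos hp]
  exact ofReal_ne_top

theorem optimality_upper (hκ : 0 < κ) [IsFiniteMeasure π] [IsFiniteMeasure μ0] [IsFiniteMeasure μ1]
    (hmin : HKfun κ π μ0 μ1 = HK2 κ μ0 μ1) :
    ∀ᵐ p ∂π,
      dens (π.map Prod.fst) μ0 p.1 * dens (π.map Prod.snd) μ1 p.2 ≤ cosKer κ p.1 p.2 ^ 2 := by
  have hfin : HKfun κ π μ0 μ1 ≠ ⊤ := by rw [hmin]; exact HK2_ne_top
  obtain ⟨g, g0, g1⟩ := HKfun_ne_top hκ hfin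
  have ac0 := ac_of_KLdiv_ne_top g0
  have ac1 := ac_of_KLdiv_ne_top g1
  set s0 := dens (π.map Prod.fst) μ0 with hs0
  set s1 := dens (π.map Prod.snd) μ1 with hs1
  have ms0 : Measurable s0 := measurable_dens _ _
  have ms1 : Measurable s1 := measurable_dens _ _
  have key (r : ℝ) (hr : 1 < r) : π {p | r⁻¹ ≤ cosKer κ p.1 p.2 ∧ s0 p.1 ∈ Set.Icc r⁻¹ r ∧
      s1 p.2 ∈ Set.Icc r⁻¹ r ∧
      cosKer κ p.1 p.2 ^ 2 < ((1 - r⁻¹) * s0 p.1) * ((1 - r⁻¹) * s1 p.2)} = 0 := by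
    have hr0 : 0 < r := by linarith
    have hi0 : 0 < r⁻¹ := by positivity
    have hi1 : r⁻¹ < 1 := inv_lt_one_of_one_lt₀ hr
    have hi2 : 0 < 1 - r⁻¹ := by linarith
    set A : Set (Eucl n × Eucl n) := {p | r⁻¹ ≤ cosKer κ p.1 p.2 ∧ s0 p.1 ∈ Set.Icc r⁻¹ r ∧
      s1 p.2 ∈ Set.Icc r⁻¹ r ∧
      cosKer κ p.1 p.2 ^ 2 < ((1 - r⁻¹) * s0 p.1) * ((1 - r⁻¹) * s1 p.2)} with hA
    have mk : Measurable fun p : Eucl n × Eucl n => cosKer κ p.1 p.2 := measurable_cosKer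
    have mA : MeasurableSet A := by
      refine (measurableSet_le measurable_const mk).inter
        (((ms0.comp measurable_fst) measurableSet_Icc).inter
        (((ms1.comp measurable_snd) measurableSet_Icc).inter
        (measurableSet_lt (mk.pow_const 2) ?_)))
      exact ((ms0.comp measurable_fst).const_mul _).mul ((ms1.comp measurable_snd).const_mul _)
    have hAae : ∀ᵐ p ∂(π.restrict A), p ∈ A := ae_restrict_mem mA
    set q : NNReal := ⟨1 - r⁻¹, hi2.le⟩ with hq
    have hqr : (q : ℝ) = 1 - r⁻¹ := rfl
    have hsplit : π = (1 : NNReal) • π.restrict A + (1 : NNReal) • π.restrict Aᶜ := by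
      rw [one_smul, one_smul, Measure.restrict_add_restrict_compl mA]
    have hcost := integrable_cost hκ hi0 (hAae.mono fun p hp => hp.1)
    have hcA := lintegral_cost_ne_top hκ (hAae.mono fun p hp => hi0.trans_le hp.1) hcost
    have hcAt : ∫⁻ p, cHK κ p.1 p.2 ∂(π.restrict A) ≠ ⊤ := by rw [hcA]; exact ofReal_ne_top
    have hcAc : ∫⁻ p, cHK κ p.1 p.2 ∂(π.restrict Aᶜ) ≠ ⊤ :=
      ne_top_of_le_ne_top g (setLIntegral_le_lintegral _ _)
    have hmarg (f : Eucl n × Eucl n → Eucl n) (hf : Measurable f) (μ : Measure (Eucl n))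
        [IsFiniteMeasure μ] (hac : π.map f ≪ μ) :
        (π.restrict A).map f ≪ μ ∧ (q • π.restrict A + (1 : NNReal) • π.restrict Aᶜ).map f ≪ μ ∧
        ∀ᵐ x ∂μ, klFun (dens ((q • π.restrict A + (1 : NNReal) • π.restrict Aᶜ).map f) μ x) ≤
          klFun (dens (π.map f) μ x) + -r⁻¹ * (dens ((π.restrict A).map f) μ x *
            Real.log ((1 - r⁻¹) * dens (π.map f) μ x)) := by
      have a1 : (π.restrict A).map f ≪ μ :=
        (Measure.map_mono Measure.restrict_le_self hf).absolutelyContinuous.trans hac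
      have a2 : (π.restrict Aᶜ).map f ≪ μ :=
        (Measure.map_mono Measure.restrict_le_self hf).absolutelyContinuous.trans hac
      have e1 : (q • π.restrict A + (1 : NNReal) • π.restrict Aᶜ).map f
          = q • (π.restrict A).map f + (1 : NNReal) • (π.restrict Aᶜ).map f := by
        rw [Measure.map_add _ _ hf, Measure.map_smul, Measure.map_smul]
      have e2 : π.map f = (1 : NNReal) • (π.restrict A).map f
          + (1 : NNReal) • (π.restrict Aᶜ).map f := by
        conv_lhs => rw [hsplit]
        rw [Measure.map_add _ _ hf, Measure.map_smul, Measure.map_smul]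
      refine ⟨a1, ?_, ?_⟩
      · rw [e1]
        exact (a1.smul_left _).add_left (a2.smul_left _)
      · rw [e1, e2]
        filter_upwards [dens_smul_add (ρ := (π.restrict A).map f) (ρ' := (π.restrict Aᶜ).map f)
          (μ := μ) q 1, dens_smul_add (ρ := (π.restrict A).map f) (ρ' := (π.restrict Aᶜ).map f)
          (μ := μ) 1 1] with x h1 h2
        rw [h1, h2, hqr]
        simp only [NNReal.coe_one, one_mul]
        exact klFun_remove_le (dens_nonneg _ _ _) (dens_nonneg _ _ _) hi0 hi1
    obtain ⟨b0, b0', k0⟩ := hmarg _ measurable_fst μ0 ac0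
    obtain ⟨b1, b1', k1⟩ := hmarg _ measurable_snd μ1 ac1
    have hint (F : Eucl n × Eucl n → ℝ) (hF : Measurable F)
        (h : ∀ p ∈ A, F p ∈ Set.Icc r⁻¹ r) :
        Integrable (fun p => Real.log ((1 - r⁻¹) * F p)) (π.restrict A) := by
      refine integrable_log_of_mem_Icc (hF.const_mul _) (a := (1 - r⁻¹) * r⁻¹)
        (b := (1 - r⁻¹) * r) (by positivity) ?_
      filter_upwards [hAae] with p hp
      exact ⟨mul_le_mul_of_nonneg_left (h p hp).1 hi2.le,
        mul_le_mul_of_nonneg_left (h p hp).2 hi2.le⟩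
    have j0 := hint (fun p => s0 p.1) (ms0.comp measurable_fst) fun p hp => hp.2.1
    have j1 := hint (fun p => s1 p.2) (ms1.comp measurable_snd) fun p hp => hp.2.2.1
    have hL : ∫⁻ p, cHK κ p.1 p.2 ∂π = ∫⁻ p, cHK κ p.1 p.2 ∂(π.restrict A)
        + ∫⁻ p, cHK κ p.1 p.2 ∂(π.restrict Aᶜ) := by
      conv_lhs => rw [hsplit]
      rw [lintegral_add_measure, one_smul, one_smul]
    have hL' : ∫⁻ p, cHK κ p.1 p.2 ∂(q • π.restrict A + (1 : NNReal) • π.restrict Aᶜ)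
        = q * ∫⁻ p, cHK κ p.1 p.2 ∂(π.restrict A) + ∫⁻ p, cHK κ p.1 p.2 ∂(π.restrict Aᶜ) := by
      rw [lintegral_add_measure, one_smul, lintegral_smul_measure]; rfl
    have hcπ : ∫⁻ p, cHK κ p.1 p.2 ∂(q • π.restrict A + (1 : NNReal) • π.restrict Aᶜ) ≠ ⊤ := by
      rw [hL']
      exact add_ne_top.2 ⟨mul_ne_top coe_ne_top hcAt, hcAc⟩
    have hct : (∫⁻ p, cHK κ p.1 p.2 ∂(q • π.restrict A + (1 : NNReal) • π.restrict Aᶜ)).toReal ≤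
        (∫⁻ p, cHK κ p.1 p.2 ∂π).toReal
          + -r⁻¹ * ∫ p, (cHK κ p.1 p.2).toReal ∂(π.restrict A) := by
      rw [hL', hL, toReal_add (mul_ne_top coe_ne_top hcAt) hcAc, toReal_add hcAt hcAc, toReal_mul,
        hcA, toReal_ofReal (integral_nonneg fun p => toReal_nonneg), coe_toReal, hqr]
      linarith
    have hv := first_variation_nonneg hκ hfin (by rw [hmin]; exact HK2_le)
      (f0 := fun x => Real.log ((1 - r⁻¹) * s0 x)) (f1 := fun x => Real.log ((1 - r⁻¹) * s1 x))
      (Real.measurable_log.comp (ms0.const_mul _)) (Real.measurable_log.comp (ms1.const_mul _))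
      b0 b1 j0 j1 hcost b0' b1' k0 k1 hcπ hct
    rw [← Measure.restrict_eq_zero]
    refine measure_eq_zero_of_integral_nonpos
      ((hcost.add (j0.const_mul (κ ^ 2))).add (j1.const_mul (κ ^ 2))) ?_ ?_
    · filter_upwards [hAae] with p hp
      have q0 := hi0.trans_le hp.1
      have p0 := hi0.trans_le hp.2.1.1
      have p1 := hi0.trans_le hp.2.2.1.1
      refine lt_of_lt_of_eq ?_ (cost_add_logs hκ q0 (mul_pos hi2 p0) (mul_pos hi2 p1)).symm
      have := Real.log_lt_log (by positivity) hp.2.2.2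
      have := sub_pos.2 this
      positivity
    · by_contra! hlt
      have := mul_pos hi0 hlt
      simp only [Pi.add_apply] at this
      linarith
  have hall : ∀ᵐ p ∂π, ∀ j : ℕ, ¬ (((j : ℝ) + 2)⁻¹ ≤ cosKer κ p.1 p.2 ∧
      s0 p.1 ∈ Set.Icc ((j : ℝ) + 2)⁻¹ ((j : ℝ) + 2) ∧
      s1 p.2 ∈ Set.Icc ((j : ℝ) + 2)⁻¹ ((j : ℝ) + 2) ∧
      cosKer κ p.1 p.2 ^ 2 <
        ((1 - ((j : ℝ) + 2)⁻¹) * s0 p.1) * ((1 - ((j : ℝ) + 2)⁻¹) * s1 p.2)) := by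
    rw [ae_all_iff]
    intro j
    rw [ae_iff]
    simp only [not_not]
    exact key _ (by have : (0 : ℝ) ≤ j := j.cast_nonneg; linarith)
  filter_upwards [hall, cosKer_pos_ae hκ hfin,
    ae_of_ae_map measurable_fst.aemeasurable (dens_pos_ae ac0),
    ae_of_ae_map measurable_snd.aemeasurable (dens_pos_ae ac1)] with p hp hk hp0 hp1
  by_contra! hlt
  have t1 : Tendsto (fun j : ℕ => (j : ℝ) + 2) atTop atTop :=
    tendsto_atTop_add_const_right _ _ tendsto_natCast_atTop_atTop
  have t2 : Tendsto (fun j : ℕ => ((j : ℝ) + 2)⁻¹) atTop (𝓝 0) := t1.inv_tendsto_atTop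
  have t3 : Tendsto (fun j : ℕ => ((1 - ((j : ℝ) + 2)⁻¹) * s0 p.1) *
      ((1 - ((j : ℝ) + 2)⁻¹) * s1 p.2)) atTop (𝓝 (((1 - 0) * s0 p.1) * ((1 - 0) * s1 p.2))) :=
    ((t2.const_sub 1).mul_const _).mul ((t2.const_sub 1).mul_const _)
  simp only [sub_zero, one_mul] at t3
  obtain ⟨j, h1, h2, h3, h4, h5, h6⟩ := ((t2.eventually_le_const hk).and
    ((t2.eventually_le_const hp0).and ((t2.eventually_le_const hp1).and
    ((t1.eventually_ge_atTop (s0 p.1)).and ((t1.eventually_ge_atTop (s1 p.2)).and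
    (t3.eventually_const_lt hlt)))))).exists
  exact hp j ⟨h1, ⟨h2, h4⟩, ⟨h3, h5⟩, h6⟩

end Optimality

section OptimalityLower

theorem dens_le_of_le_smul {α : Type*} [MeasurableSpace α] {ρ μ : Measure α} [IsFiniteMeasure ρ]
    [IsFiniteMeasure μ] {C : ℝ} (hC : 0 ≤ C) (h : ρ ≤ ENNReal.ofReal C • μ) :
    ∀ᵐ x ∂μ, dens ρ μ x ≤ C := by
  have : ρ.rnDeriv μ ≤ᵐ[μ] fun _ => ENNReal.ofReal C := by
    refine ae_le_of_forall_setLIntegral_le_of_sigmaFinite₀ (by fun_prop) ?_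
    intro s _ _
    rw [setLIntegral_const]
    exact (Measure.setLIntegral_rnDeriv_le s).trans (h s)
  filter_upwards [this] with x hx
  exact toReal_le_of_le_ofReal hC hx

variable {n : ℕ} {κ : ℝ} {π : Measure (Eucl n × Eucl n)} {μ0 μ1 : Measure (Eucl n)}

theorem optimality_lower (hκ : 0 < κ) [IsFiniteMeasure π] [IsFiniteMeasure μ0] [IsFiniteMeasure μ1]
    (hmin : HKfun κ π μ0 μ1 = HK2 κ μ0 μ1) :
    ∀ᵐ p ∂(μ0.prod μ1),
      cosKer κ p.1 p.2 ^ 2 ≤ dens (π.map Prod.fst) μ0 p.1 * dens (π.map Prod.snd) μ1 p.2 := by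
  have hfin : HKfun κ π μ0 μ1 ≠ ⊤ := by rw [hmin]; exact HK2_ne_top
  obtain ⟨g, g0, g1⟩ := HKfun_ne_top hκ hfin
  have ac0 := ac_of_KLdiv_ne_top g0
  have ac1 := ac_of_KLdiv_ne_top g1
  set s0 := dens (π.map Prod.fst) μ0 with hs0
  set s1 := dens (π.map Prod.snd) μ1 with hs1
  have ms0 : Measurable s0 := measurable_dens _ _
  have ms1 : Measurable s1 := measurable_dens _ _
  have key (δ r : ℝ) (hδ : 0 < δ) : (μ0.prod μ1) {p | (s0 p.1 + δ) * (s1 p.2 + δ)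
      < cosKer κ p.1 p.2 ^ 2 ∧ s0 p.1 ≤ r ∧ s1 p.2 ≤ r} = 0 := by
    set B : Set (Eucl n × Eucl n) := {p | (s0 p.1 + δ) * (s1 p.2 + δ)
      < cosKer κ p.1 p.2 ^ 2 ∧ s0 p.1 ≤ r ∧ s1 p.2 ≤ r} with hB
    have mk : Measurable fun p : Eucl n × Eucl n => cosKer κ p.1 p.2 := measurable_cosKer
    have mB : MeasurableSet B := by
      refine (measurableSet_lt ?_ (mk.pow_const 2)).inter
        ((measurableSet_le (ms0.comp measurable_fst) measurable_const).inter
        (measurableSet_le (ms1.comp measurable_snd) measurable_const))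
      exact ((ms0.comp measurable_fst).add_const _).mul ((ms1.comp measurable_snd).add_const _)
    set γ := (μ0.prod μ1).restrict B with hγ
    have hBae : ∀ᵐ p ∂γ, p ∈ B := ae_restrict_mem mB
    have hs0n (x) : 0 ≤ s0 x := dens_nonneg _ _ _
    have hs1n (x) : 0 ≤ s1 x := dens_nonneg _ _ _
    have hker : ∀ᵐ p ∂γ, δ ≤ cosKer κ p.1 p.2 := by
      filter_upwards [hBae] with p hp
      refine le_of_lt (lt_of_pow_lt_pow_left₀ 2 (cosKer_nonneg _ _) (lt_of_le_of_lt ?_ hp.1))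
      nlinarith [hs0n p.1, hs1n p.2, mul_nonneg (hs0n p.1) (hs1n p.2)]
    set M : ℝ := μ0.real Set.univ + μ1.real Set.univ + 1 with hM
    have hM0 : 0 ≤ μ0.real Set.univ := measureReal_nonneg
    have hM1 : 0 ≤ μ1.real Set.univ := measureReal_nonneg
    have hMp : 0 < M := by positivity
    set ε : NNReal := ⟨δ / M, by positivity⟩ with hε
    have hεr : (ε : ℝ) = δ / M := rfl
    have hεp : (0 : ℝ) < ε := by rw [hεr]; positivity
    have hcost := integrable_cost hκ hδ hker
    have hcB := lintegral_cost_ne_top hκ (hker.mono fun p hp => hδ.trans_le hp) hcost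
    have hcBt : ∫⁻ p, cHK κ p.1 p.2 ∂γ ≠ ⊤ := by rw [hcB]; exact ofReal_ne_top
    have hmarg (f : Eucl n × Eucl n → Eucl n) (hf : Measurable f) (μ ν : Measure (Eucl n))
        [IsFiniteMeasure μ] [IsFiniteMeasure ν] (hν : ν.real Set.univ ≤ M)
        (hac : π.map f ≪ μ) (hfμ : (μ0.prod μ1).map f = (ν Set.univ) • μ) :
        γ.map f ≪ μ ∧ ((1 : NNReal) • π + ε • γ).map f ≪ μ ∧
        ∀ᵐ x ∂μ, klFun (dens (((1 : NNReal) • π + ε • γ).map f) μ x) ≤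
          klFun (dens (π.map f) μ x) + ε * (dens (γ.map f) μ x *
            Real.log (dens (π.map f) μ x + δ)) := by
      have a0 : γ.map f ≤ ENNReal.ofReal M • μ := by
        refine (Measure.map_mono Measure.restrict_le_self hf).trans ?_
        rw [hfμ]
        refine Measure.le_intro fun s _ _ => ?_
        simp only [Measure.smul_apply, smul_eq_mul]
        gcongr
        rw [← ofReal_toReal (measure_ne_top ν Set.univ)]
        exact ofReal_le_ofReal hν
      have a1 : γ.map f ≪ μ :=
        (Measure.absolutelyContinuous_of_le a0).trans Measure.smul_absolutelyContinuous
      have e1 : ((1 : NNReal) • π + ε • γ).map f = (1 : NNReal) • π.map f + ε • γ.map f := by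
        rw [Measure.map_add _ _ hf, Measure.map_smul, Measure.map_smul]
      refine ⟨a1, ?_, ?_⟩
      · rw [e1]
        exact (hac.smul_left _).add_left (a1.smul_left _)
      · rw [e1]
        filter_upwards [dens_smul_add (ρ := π.map f) (ρ' := γ.map f) (μ := μ) 1 ε,
          dens_le_of_le_smul hMp.le a0] with x h1 h2
        rw [h1]
        simp only [NNReal.coe_one, one_mul]
        refine klFun_add_le (dens_nonneg _ _ _) (dens_nonneg _ _ _) hεp ?_
        rw [hεr, div_mul_eq_mul_div, div_le_iff₀ hMp]
        gcongr
    obtain ⟨b0, b0', k0⟩ := hmarg _ measurable_fst μ0 μ1 (by linarith) ac0 Measure.map_fst_prod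
    obtain ⟨b1, b1', k1⟩ := hmarg _ measurable_snd μ1 μ0 (by linarith) ac1 Measure.map_snd_prod
    have hint (F : Eucl n × Eucl n → ℝ) (hF : Measurable F) (hn : ∀ p, 0 ≤ F p)
        (h : ∀ p ∈ B, F p ≤ r) : Integrable (fun p => Real.log (F p + δ)) γ := by
      refine integrable_log_of_mem_Icc (hF.add_const _) (b := r + δ) hδ ?_
      filter_upwards [hBae] with p hp
      exact ⟨by linarith [hn p], by linarith [h p hp]⟩
    have j0 := hint (fun p => s0 p.1) (ms0.comp measurable_fst) (fun p => hs0n _)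
      fun p hp => hp.2.1
    have j1 := hint (fun p => s1 p.2) (ms1.comp measurable_snd) (fun p => hs1n _)
      fun p hp => hp.2.2
    have hL' : ∫⁻ p, cHK κ p.1 p.2 ∂((1 : NNReal) • π + ε • γ)
        = ∫⁻ p, cHK κ p.1 p.2 ∂π + ε * ∫⁻ p, cHK κ p.1 p.2 ∂γ := by
      rw [lintegral_add_measure, one_smul, lintegral_smul_measure]; rfl
    have hcπ : ∫⁻ p, cHK κ p.1 p.2 ∂((1 : NNReal) • π + ε • γ) ≠ ⊤ := by
      rw [hL']
      exact add_ne_top.2 ⟨g, mul_ne_top coe_ne_top hcBt⟩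
    have hct : (∫⁻ p, cHK κ p.1 p.2 ∂((1 : NNReal) • π + ε • γ)).toReal ≤
        (∫⁻ p, cHK κ p.1 p.2 ∂π).toReal + ε * ∫ p, (cHK κ p.1 p.2).toReal ∂γ := by
      rw [hL', toReal_add g (mul_ne_top coe_ne_top hcBt), toReal_mul,
        hcB, toReal_ofReal (integral_nonneg fun p => toReal_nonneg), coe_toReal]
    have hv := first_variation_nonneg hκ hfin (by rw [hmin]; exact HK2_le)
      (f0 := fun x => Real.log (s0 x + δ)) (f1 := fun x => Real.log (s1 x + δ))
      (Real.measurable_log.comp (ms0.add_const _)) (Real.measurable_log.comp (ms1.add_const _))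
      b0 b1 j0 j1 hcost b0' b1' k0 k1 hcπ hct
    rw [← Measure.restrict_eq_zero]
    refine measure_eq_zero_of_integral_nonpos
      ((hcost.add (j0.const_mul (κ ^ 2))).add (j1.const_mul (κ ^ 2))).neg ?_ ?_
    · filter_upwards [hBae, hker] with p hp hq
      have p0 : 0 < s0 p.1 + δ := by linarith [hs0n p.1]
      have p1 : 0 < s1 p.2 + δ := by linarith [hs1n p.2]
      have e := cost_add_logs hκ (hδ.trans_le hq) p0 p1
      have := sub_neg.2 (Real.log_lt_log (by positivity) hp.1)
      simp only [Pi.neg_apply, Pi.add_apply]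
      rw [e, ← mul_neg]
      have := neg_pos.2 this
      positivity
    · simp only [Pi.neg_apply, Pi.add_apply, integral_neg]
      by_contra! hlt
      nlinarith
  have hall : ∀ᵐ p ∂(μ0.prod μ1), ∀ j : ℕ, ¬ ((s0 p.1 + ((j : ℝ) + 1)⁻¹) *
      (s1 p.2 + ((j : ℝ) + 1)⁻¹) < cosKer κ p.1 p.2 ^ 2 ∧ s0 p.1 ≤ j ∧ s1 p.2 ≤ j) := by
    rw [ae_all_iff]
    intro j
    rw [ae_iff]
    simp only [not_not]
    exact key _ _ (by positivity)
  filter_upwards [hall] with p hp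
  by_contra! hlt
  have t1 : Tendsto (fun j : ℕ => (j : ℝ)) atTop atTop := tendsto_natCast_atTop_atTop
  have t2 : Tendsto (fun j : ℕ => ((j : ℝ) + 1)⁻¹) atTop (𝓝 0) :=
    (tendsto_atTop_add_const_right _ _ t1).inv_tendsto_atTop
  have t3 : Tendsto (fun j : ℕ => (s0 p.1 + ((j : ℝ) + 1)⁻¹) * (s1 p.2 + ((j : ℝ) + 1)⁻¹)) atTop
      (𝓝 ((s0 p.1 + 0) * (s1 p.2 + 0))) := (t2.const_add _).mul (t2.const_add _)
  simp only [add_zero] at t3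
  obtain ⟨j, h1, h2, h3⟩ := ((t1.eventually_ge_atTop (s0 p.1)).and
    ((t1.eventually_ge_atTop (s1 p.2)).and (t3.eventually_lt_const hlt))).exists
  exact hp j ⟨h3, h1, h2⟩

end OptimalityLower

section Graph

variable {n : ℕ} {κ : ℝ}

/-- An almost everywhere bound `k ^ 2 ≤ s₀ ⊗ s₁` holds on a product of two conull sets. -/
theorem exists_conull_rect {α β : Type*} [MeasurableSpace α] [TopologicalSpace β]
    [SecondCountableTopology β] [MeasurableSpace β] [BorelSpace β] {μ0 : Measure α}
    {μ1 : Measure β} [SFinite μ1] {k : α → β → ℝ} (hk : ∀ x, Continuous (k x))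
    {s0 : α → ℝ} {s1 : β → ℝ} (hs1 : Measurable s1)
    (h : ∀ᵐ p ∂(μ0.prod μ1), k p.1 p.2 ^ 2 ≤ s0 p.1 * s1 p.2) :
    ∃ (X : Set α) (S : Set β), (∀ᵐ x ∂μ0, x ∈ X) ∧ (∀ᵐ y ∂μ1, y ∈ S) ∧
      ∀ x ∈ X, ∀ y ∈ S, k x y ^ 2 ≤ s0 x * s1 y := by
  have mΦ : Measurable fun y : β => (y, s1 y) := measurable_id.prodMk hs1
  refine ⟨{x | ∀ᵐ y ∂μ1, k x y ^ 2 ≤ s0 x * s1 y},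
    (fun y : β => (y, s1 y)) ⁻¹' (μ1.map fun y : β => (y, s1 y)).support,
    Measure.ae_ae_of_ae_prod h, ae_of_ae_map mΦ.aemeasurable Measure.support_mem_ae, ?_⟩
  intro x hx y hy
  have hc : IsClosed {q : β × ℝ | k x q.1 ^ 2 ≤ s0 x * q.2} :=
    isClosed_le (((hk x).comp continuous_fst).pow 2) (continuous_const.mul continuous_snd)
  exact Measure.support_subset_of_isClosed hc
    ((ae_map_iff mΦ.aemeasurable hc.measurableSet).2 hx) hy

theorem continuous_cosKer_left (y : Eucl n) : Continuous fun x => cosKer κ x y :=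
  lipschitzWith_truncCos.continuous.comp ((continuous_id.dist continuous_const).div_const κ)

theorem continuous_cosKer_right (x : Eucl n) : Continuous fun y => cosKer κ x y :=
  lipschitzWith_truncCos.continuous.comp ((continuous_const.dist continuous_id).div_const κ)

theorem hasFDerivAt_cosKer (hκ : 0 < κ) {x y : Eucl n} (h : 0 < cosKer κ x y) :
    HasFDerivAt (fun z => cosKer κ z y)
      (-(κ⁻¹ * Real.sin (dist x y / κ) / dist x y) • innerSL ℝ (x - y)) x := by
  have hev : (fun z => cosKer κ z y) =ᶠ[𝓝 x] fun z => Real.cos (‖z - y‖ / κ) := by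
    have hcont : Continuous fun z => cosKer κ z y := continuous_cosKer_left y
    have hpos : ∀ᶠ z in 𝓝 x, 0 < cosKer κ z y :=
      (isOpen_lt continuous_const hcont).mem_nhds h
    filter_upwards [hpos] with z hz
    rw [cosKer_of_lt hκ ((cosKer_pos_iff hκ).1 hz), dist_eq_norm]
  refine HasFDerivAt.congr_of_eventuallyEq ?_ hev
  rw [dist_eq_norm]
  by_cases hxy : x = y
  · subst hxy
    simp only [sub_self, norm_zero, _root_.div_zero, neg_zero, zero_smul]
    have hO : (fun z : Eucl n => Real.cos (‖z - x‖ / κ) - 1) =O[𝓝 x] fun z => ‖z - x‖ ^ 2 := by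
      refine Asymptotics.IsBigO.of_bound ((κ ^ 2)⁻¹) (Eventually.of_forall fun z => ?_)
      have h1 := Real.one_sub_sq_div_two_le_cos (x := ‖z - x‖ / κ)
      have h2 := Real.cos_le_one (‖z - x‖ / κ)
      have h3 : 0 ≤ (‖z - x‖ / κ) ^ 2 := by positivity
      have h4 : (κ ^ 2)⁻¹ * ‖z - x‖ ^ 2 = (‖z - x‖ / κ) ^ 2 := by rw [div_pow]; ring
      rw [Real.norm_eq_abs, abs_le, norm_pow, norm_norm, h4]
      constructor <;> linarith
    simpa using (hO.hasFDerivAt (𝕜 := ℝ) one_lt_two).add_const 1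
  · have hz : x - y ≠ 0 := sub_ne_zero.2 hxy
    have hz' : ‖x - y‖ ≠ 0 := norm_ne_zero_iff.2 hz
    have h1 : HasFDerivAt (fun z : Eucl n => ‖z - y‖ ^ 2)
        (2 • (innerSL ℝ (x - y)).comp (ContinuousLinearMap.id ℝ (Eucl n))) x :=
      ((hasFDerivAt_id x).sub_const y).norm_sq
    have h2 := h1.sqrt (by positivity)
    simp only [Real.sqrt_sq (norm_nonneg _)] at h2
    have h3 := (h2.const_mul κ⁻¹).cos
    refine (h3.congr_fderiv ?_).congr_of_eventuallyEq (Eventually.of_forall fun z => ?_)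
    · ext v
      simp only [smul_apply, ContinuousLinearMap.comp_id, smul_eq_mul,
        nsmul_eq_mul]
      field_simp
      simp
    · simp only [div_eq_inv_mul]

/-- On the positivity set of the kernel, its logarithmic gradient in the first variable
determines the second variable. -/
theorem eq_of_log_gradient_eq (hκ : 0 < κ) {x y y' : Eucl n} (h : 0 < cosKer κ x y)
    (h' : 0 < cosKer κ x y')
    (e : (cosKer κ x y)⁻¹ • (-(κ⁻¹ * Real.sin (dist x y / κ) / dist x y) • innerSL ℝ (x - y)) =
      (cosKer κ x y')⁻¹ • (-(κ⁻¹ * Real.sin (dist x y' / κ) / dist x y') • innerSL ℝ (x - y'))) :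
    y = y' := by
  have hform (z : Eucl n) (hz : 0 < cosKer κ x z) :
      (cosKer κ x z)⁻¹ • (-(κ⁻¹ * Real.sin (dist x z / κ) / dist x z) • innerSL ℝ (x - z)) =
        innerSL ℝ ((-(κ⁻¹ * Real.tan (dist x z / κ) / dist x z)) • (x - z)) := by
    rw [map_smul, smul_smul]
    congr 1
    rw [cosKer_of_lt hκ ((cosKer_pos_iff hκ).1 hz), Real.tan_eq_sin_div_cos]
    ring
  rw [hform y h, hform y' h'] at e
  have e' : (-(κ⁻¹ * Real.tan (dist x y / κ) / dist x y)) • (x - y) =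
      (-(κ⁻¹ * Real.tan (dist x y' / κ) / dist x y')) • (x - y') := by
    refine ext_inner_right ℝ fun v => ?_
    exact DFunLike.congr_fun e v
  have hr (z : Eucl n) (hz : 0 < cosKer κ x z) : 0 ≤ dist x z / κ ∧ dist x z / κ < Real.pi / 2 := by
    refine ⟨by positivity, ?_⟩
    rw [div_lt_iff₀ hκ]
    linarith [(cosKer_pos_iff hκ).1 hz]
  have hnorm (z : Eucl n) (hz : 0 < cosKer κ x z) :
      ‖(-(κ⁻¹ * Real.tan (dist x z / κ) / dist x z)) • (x - z)‖
        = κ⁻¹ * Real.tan (dist x z / κ) := by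
    have ht := Real.tan_nonneg_of_nonneg_of_le_pi_div_two (hr z hz).1 (hr z hz).2.le
    rw [norm_smul, ← dist_eq_norm, norm_neg, Real.norm_of_nonneg (by positivity)]
    by_cases h0 : dist x z = 0
    · simp [h0]
    · field_simp
  have e2 := congrArg norm e'
  rw [hnorm y h, hnorm y' h'] at e2
  have e3 := mul_left_cancel₀ (inv_pos.2 hκ).ne' e2
  have hpi := Real.pi_pos
  have e4 := Real.tan_inj_of_lt_of_lt_pi_div_two (by linarith [(hr y h).1]) (hr y h).2
    (by linarith [(hr y' h').1]) (hr y' h').2 e3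
  have e5 : dist x y = dist x y' := by field_simp at e4; exact e4
  by_cases h0 : dist x y = 0
  · exact (dist_eq_zero.1 h0).symm.trans (dist_eq_zero.1 (e5 ▸ h0))
  · rw [← e5] at e'
    have hp : 0 < dist x y := lt_of_le_of_ne dist_nonneg (Ne.symm h0)
    have ht : 0 < Real.tan (dist x y / κ) :=
      Real.tan_pos_of_pos_of_lt_pi_div_two (by positivity) (hr y h).2
    have hc : -(κ⁻¹ * Real.tan (dist x y / κ) / dist x y) ≠ 0 := neg_ne_zero.2 (by positivity)
    have := smul_right_injective (Eucl n) hc e'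
    exact sub_right_injective this

/-- The `c`-transform restricted to points where the potential is at least `(m + 1)⁻¹`. -/
noncomputable def cosTransform (κ : ℝ) (S : Set (Eucl n)) (τ : Eucl n → ℝ) (m : ℕ) (x : Eucl n) :
    ℝ := ⨆ y : {y // y ∈ S ∧ ((m : ℝ) + 1)⁻¹ ≤ τ y}, cosKer κ x y / τ y

variable {S : Set (Eucl n)} {τ : Eucl n → ℝ} {m : ℕ}

theorem bddAbove_cosTransform (x : Eucl n) : BddAbove (Set.range
    fun y : {y // y ∈ S ∧ ((m : ℝ) + 1)⁻¹ ≤ τ y} => cosKer κ x y / τ y) := by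
  refine ⟨(m : ℝ) + 1, ?_⟩
  rintro _ ⟨⟨y, _, hy⟩, rfl⟩
  have h1 : (0 : ℝ) < (m : ℝ) + 1 := by positivity
  have h2 : 0 < τ y := lt_of_lt_of_le (by positivity) hy
  simp only
  rw [div_le_iff₀ h2]
  calc cosKer κ x y ≤ 1 := cosKer_le_one x y
    _ = ((m : ℝ) + 1) * ((m : ℝ) + 1)⁻¹ := (mul_inv_cancel₀ h1.ne').symm
    _ ≤ _ := by gcongr

theorem le_cosTransform {y : Eucl n} (hS : y ∈ S) (hy : ((m : ℝ) + 1)⁻¹ ≤ τ y) (x : Eucl n) :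
    cosKer κ x y / τ y ≤ cosTransform κ S τ m x :=
  le_ciSup (bddAbove_cosTransform x) ⟨y, hS, hy⟩

theorem cosTransform_le {x : Eucl n} {a : ℝ} (ha : 0 ≤ a)
    (h : ∀ y ∈ S, cosKer κ x y ≤ a * τ y) : cosTransform κ S τ m x ≤ a := by
  refine Real.iSup_le (fun y => ?_) ha
  have h2 : 0 < τ y := lt_of_lt_of_le (by positivity) y.2.2
  rw [div_le_iff₀ h2]
  exact h y y.2.1

theorem lipschitzWith_cosTransform (hκ : 0 < κ) :
    ∃ C, LipschitzWith C (cosTransform κ S τ m) := by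
  refine ⟨_, LipschitzWith.of_le_add_mul' (((m : ℝ) + 1) * κ⁻¹) fun x x' => ?_⟩
  rcases isEmpty_or_nonempty {y // y ∈ S ∧ ((m : ℝ) + 1)⁻¹ ≤ τ y} with he | he
  · simp only [cosTransform, Real.iSup_of_isEmpty]
    positivity
  · refine ciSup_le fun y => ?_
    have h1 : (0 : ℝ) < (m : ℝ) + 1 := by positivity
    have h2 : 0 < τ y := lt_of_lt_of_le (by positivity) y.2.2
    have h3 : (τ y)⁻¹ ≤ (m : ℝ) + 1 := inv_le_of_inv_le₀ h1 y.2.2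
    have h4 := cosKer_sub_le hκ x x' (y : Eucl n)
    calc cosKer κ x y / τ y ≤ (cosKer κ x' y + κ⁻¹ * dist x x') / τ y := by gcongr; linarith
      _ = cosKer κ x' y / τ y + (τ y)⁻¹ * (κ⁻¹ * dist x x') := by ring
      _ ≤ cosTransform κ S τ m x' + ((m : ℝ) + 1) * (κ⁻¹ * dist x x') := by
        gcongr
        exact le_cosTransform y.2.1 y.2.2 x'
      _ = _ := by ring

theorem hasFDerivAt_cosTransform_eq (hκ : 0 < κ) {x y : Eucl n} {a : ℝ} (ha : 0 ≤ a)
    (hx : ∀ y ∈ S, cosKer κ x y ≤ a * τ y) (hS : y ∈ S) (hy : ((m : ℝ) + 1)⁻¹ ≤ τ y)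
    (he : cosKer κ x y = a * τ y) (hp : 0 < cosKer κ x y)
    (hd : DifferentiableAt ℝ (cosTransform κ S τ m) x) :
    a⁻¹ • fderiv ℝ (cosTransform κ S τ m) x = (cosKer κ x y)⁻¹ •
      (-(κ⁻¹ * Real.sin (dist x y / κ) / dist x y) • innerSL ℝ (x - y)) := by
  have hτ : 0 < τ y := lt_of_lt_of_le (by positivity) hy
  have ha' : a ≠ 0 := by rintro rfl; simp [he] at hp
  have hval : cosTransform κ S τ m x = cosKer κ x y / τ y := by
    refine le_antisymm ?_ (le_cosTransform hS hy x)
    rw [he, mul_div_cancel_right₀ _ hτ.ne']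
    exact cosTransform_le ha hx
  have h1 := hd.hasFDerivAt.sub ((hasFDerivAt_cosKer hκ hp).const_mul (τ y)⁻¹)
  have h2 : IsLocalMin (cosTransform κ S τ m - fun z => (τ y)⁻¹ * cosKer κ z y) x := by
    refine Eventually.of_forall fun z => ?_
    have h3 := le_cosTransform (κ := κ) hS hy z
    simp only [Pi.sub_apply]
    rw [hval, div_eq_inv_mul, sub_self]
    rw [div_eq_inv_mul] at h3
    linarith
  have h4 := sub_eq_zero.1 (h2.hasFDerivAt_eq_zero h1)
  rw [h4, smul_smul, he, mul_inv]

/-- The contact set of a pair of potentials, over differentiability points of the transforms. -/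
def contactSet (κ : ℝ) (X S : Set (Eucl n)) (τ0 τ1 : Eucl n → ℝ) : Set (Eucl n × Eucl n) :=
  {p | p.1 ∈ X ∧ p.2 ∈ S ∧ (∀ m, DifferentiableAt ℝ (cosTransform κ S τ1 m) p.1) ∧
    cosKer κ p.1 p.2 = τ0 p.1 * τ1 p.2 ∧ 0 < cosKer κ p.1 p.2}

theorem contactSet_eq (hκ : 0 < κ) {X S : Set (Eucl n)} {τ0 τ1 : Eucl n → ℝ}
    (h0 : ∀ x, 0 ≤ τ0 x) (h1 : ∀ y, 0 ≤ τ1 y)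
    (hXS : ∀ x ∈ X, ∀ y ∈ S, cosKer κ x y ≤ τ0 x * τ1 y) {x y y' : Eucl n}
    (h : (x, y) ∈ contactSet κ X S τ0 τ1) (h' : (x, y') ∈ contactSet κ X S τ0 τ1) : y = y' := by
  obtain ⟨hx, hy, hd, he, hp⟩ := h
  obtain ⟨-, hy', -, he', hp'⟩ := h'
  simp only at hx hy hd he hp hy' he' hp'
  have pos {z : Eucl n} (hz : 0 < cosKer κ x z) (e : cosKer κ x z = τ0 x * τ1 z) : 0 < τ1 z := by
    refine lt_of_le_of_ne (h1 z) fun h0 => ?_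
    rw [e, ← h0, mul_zero] at hz
    exact hz.false
  have t2 : Tendsto (fun j : ℕ => ((j : ℝ) + 1)⁻¹) atTop (𝓝 0) :=
    (tendsto_atTop_add_const_right _ _ tendsto_natCast_atTop_atTop).inv_tendsto_atTop
  obtain ⟨m, hm, hm'⟩ := ((t2.eventually_le_const (pos hp he)).and
    (t2.eventually_le_const (pos hp' he'))).exists
  refine eq_of_log_gradient_eq hκ hp hp' ?_
  rw [← hasFDerivAt_cosTransform_eq hκ (h0 x) (hXS x hx) hy hm he hp (hd m),
    ← hasFDerivAt_cosTransform_eq hκ (h0 x) (hXS x hx) hy' hm' he' hp' (hd m)]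

/-- A minimizer is concentrated on the graph of a partial function of the first variable. -/
theorem exists_graph {π : Measure (Eucl n × Eucl n)} {μ0 μ1 : Measure (Eucl n)} (hκ : 0 < κ)
    [IsFiniteMeasure π] [IsFiniteMeasure μ0] [IsFiniteMeasure μ1] (hvol : μ0 ≪ volume)
    (hmin : HKfun κ π μ0 μ1 = HK2 κ μ0 μ1) :
    ∃ G : Set (Eucl n × Eucl n), (∀ᵐ p ∂π, p ∈ G) ∧
      ∀ x y y', (x, y) ∈ G → (x, y') ∈ G → y = y' := by
  have hfin : HKfun κ π μ0 μ1 ≠ ⊤ := by rw [hmin]; exact HK2_ne_top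
  obtain ⟨-, g0, g1⟩ := HKfun_ne_top hκ hfin
  have ac0 := ac_of_KLdiv_ne_top g0
  have ac1 := ac_of_KLdiv_ne_top g1
  obtain ⟨X, S, hX, hS, hXS⟩ := exists_conull_rect (k := fun x y => cosKer κ x y)
    (fun x => continuous_cosKer_right x)
    (measurable_dens _ _) (optimality_lower hκ hmin)
  have hXS' : ∀ x ∈ X, ∀ y ∈ S, cosKer κ x y ≤
      √(dens (π.map Prod.fst) μ0 x) * √(dens (π.map Prod.snd) μ1 y) := by
    intro x hx y hy
    rw [← Real.sqrt_mul (dens_nonneg _ _ _)]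
    exact Real.le_sqrt_of_sq_le (hXS x hx y hy)
  refine ⟨contactSet κ X S (fun x => √(dens (π.map Prod.fst) μ0 x))
    (fun y => √(dens (π.map Prod.snd) μ1 y)), ?_, fun x y y' h h' =>
      contactSet_eq hκ (fun _ => Real.sqrt_nonneg _) (fun _ => Real.sqrt_nonneg _) hXS' h h'⟩
  have hdiff : ∀ᵐ x ∂μ0, ∀ m, DifferentiableAt ℝ
      (cosTransform κ S (fun y => √(dens (π.map Prod.snd) μ1 y)) m) x := by
    refine hvol.ae_le (ae_all_iff.2 fun m => ?_)
    obtain ⟨C, hC⟩ := lipschitzWith_cosTransform (S := S)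
      (τ := fun y => √(dens (π.map Prod.snd) μ1 y)) (m := m) hκ
    exact hC.ae_differentiableAt
  filter_upwards [optimality_upper hκ hmin, cosKer_pos_ae hκ hfin,
    ae_of_ae_map measurable_fst.aemeasurable (ac0.ae_le hX),
    ae_of_ae_map measurable_fst.aemeasurable (ac0.ae_le hdiff),
    ae_of_ae_map measurable_snd.aemeasurable (ac1.ae_le hS)] with p hu hp hx hd hy
  refine ⟨hx, hy, hd, le_antisymm (hXS' _ hx _ hy) ?_, hp⟩
  rw [← Real.sqrt_mul (dens_nonneg _ _ _)]
  exact Real.sqrt_le_iff.2 ⟨hp.le, hu⟩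

end Graph

section Map

variable {n : ℕ} {κ : ℝ} {π π' : Measure (Eucl n × Eucl n)} {μ0 μ1 : Measure (Eucl n)}

theorem exists_map_of_graph [IsFiniteMeasure π] {G : Set (Eucl n × Eucl n)}
    (hG : ∀ᵐ p ∂π, p ∈ G) (huniq : ∀ x y y', (x, y) ∈ G → (x, y') ∈ G → y = y') :
    ∃ T : Eucl n → Eucl n, Measurable T ∧ ∀ᵐ p ∂π, p.2 = T p.1 := by
  have hm : Measurable fun x => ∫ y, y ∂(π.condKernel x) :=
    (StronglyMeasurable.integral_kernel (κ := π.condKernel)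
      (f := fun y : Eucl n => y) stronglyMeasurable_id).measurable
  refine ⟨_, hm, ?_⟩
  have hcomp : π.fst.compProd π.condKernel = π := π.disintegrate π.condKernel
  have h1 : ∀ᵐ x ∂π.fst, ∀ᵐ y ∂(π.condKernel x), (x, y) ∈ G :=
    Measure.ae_ae_of_ae_compProd (by rwa [hcomp])
  suffices ∀ᵐ p ∂(π.fst.compProd π.condKernel), p.2 = ∫ y, y ∂(π.condKernel p.1) by
    rwa [hcomp] at this
  refine Measure.ae_compProd_of_ae_ae (p := fun p => p.2 = ∫ y, y ∂(π.condKernel p.1))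
    (measurableSet_eq_fun measurable_snd (hm.comp measurable_fst)) ?_
  filter_upwards [h1] with x hx
  obtain ⟨y0, hy0⟩ := hx.exists
  have hy : ∀ᵐ y ∂(π.condKernel x), y = y0 := hx.mono fun y hy => huniq x y y0 hy hy0
  have hT : ∫ y, y ∂(π.condKernel x) = y0 := by
    rw [integral_congr_ae hy]
    simp
  filter_upwards [hy] with y h
  rw [hT, h]

theorem eq_map_of_ae_eq {T : Eucl n → Eucl n} (hT : Measurable T) (h : ∀ᵐ p ∂π, p.2 = T p.1) :
    π = (π.map Prod.fst).map (fun x => (x, T x)) := by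
  have hT' : Measurable fun x => (x, T x) := measurable_id.prodMk hT
  rw [Measure.map_map hT' measurable_fst]
  have : (fun x => (x, T x)) ∘ Prod.fst =ᵐ[π] id := by
    filter_upwards [h] with p hp
    exact Prod.ext rfl hp.symm
  rw [Measure.map_congr this, Measure.map_id]

theorem midpoint_minimizer (hκ : 0 < κ) [IsFiniteMeasure π] [IsFiniteMeasure π']
    [IsFiniteMeasure μ0] [IsFiniteMeasure μ1] (h : HKfun κ π μ0 μ1 = HK2 κ μ0 μ1)
    (h' : HKfun κ π' μ0 μ1 = HK2 κ μ0 μ1) :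
    HKfun κ ((2⁻¹ : NNReal) • π + (2⁻¹ : NNReal) • π') μ0 μ1 = HK2 κ μ0 μ1 ∧
      hell (π.map Prod.fst) (π'.map Prod.fst) μ0 = 0 := by
  have hm := HKfun_midpoint (κ := κ) (π := π) (π' := π') (μ0 := μ0) (μ1 := μ1)
  rw [h, h', ← two_mul] at hm
  have hlow := HK2_le (κ := κ) (π := (2⁻¹ : NNReal) • π + (2⁻¹ : NNReal) • π') (μ0 := μ0)
    (μ1 := μ1)
  have ht : 2 * HK2 κ μ0 μ1 ≠ ⊤ := mul_ne_top ofNat_ne_top HK2_ne_top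
  have h1 : 2 * HKfun κ ((2⁻¹ : NNReal) • π + (2⁻¹ : NNReal) • π') μ0 μ1 = 2 * HK2 κ μ0 μ1 :=
    le_antisymm ((le_self_add.trans le_self_add).trans hm) (by gcongr)
  refine ⟨(ENNReal.mul_right_inj two_ne_zero ofNat_ne_top).1 h1, ?_⟩
  rw [h1, add_assoc] at hm
  have h2 := (ENNReal.add_le_add_iff_left ht).1 (hm.trans_eq (_root_.add_zero _).symm)
  have h3 := (add_eq_zero.1 (nonpos_iff_eq_zero.1 h2)).1
  refine (mul_eq_zero.1 h3).resolve_left ?_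
  rw [ofReal_eq_zero, not_le]
  positivity

/-- Minimizers agree when the first measure is absolutely continuous. -/
theorem minimizer_unique (hκ : 0 < κ) [IsFiniteMeasure π] [IsFiniteMeasure π']
    [IsFiniteMeasure μ0] [IsFiniteMeasure μ1] (hvol : μ0 ≪ volume)
    (h : HKfun κ π μ0 μ1 = HK2 κ μ0 μ1) (h' : HKfun κ π' μ0 μ1 = HK2 κ μ0 μ1) : π' = π := by
  obtain ⟨hmid, hhell⟩ := midpoint_minimizer hκ h h'
  obtain ⟨G, hG, huniq⟩ := exists_graph hκ hvol hmid
  obtain ⟨T, hT, hTG⟩ := exists_map_of_graph hG huniq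
  rw [ae_add_measure_iff] at hTG
  have two : (2⁻¹ : NNReal) ≠ 0 := by positivity
  have e1 := eq_map_of_ae_eq hT ((Measure.ae_smul_measure_iff two).1 hTG.1)
  have e2 := eq_map_of_ae_eq hT ((Measure.ae_smul_measure_iff two).1 hTG.2)
  have hac {ρ : Measure (Eucl n × Eucl n)} (hρ : HKfun κ ρ μ0 μ1 = HK2 κ μ0 μ1) :
      ρ.map Prod.fst ≪ μ0 :=
    ac_of_KLdiv_ne_top (HKfun_ne_top hκ (by rw [hρ]; exact HK2_ne_top)).2.1
  have e3 := eq_of_dens_ae_eq (hac h) (hac h') (dens_ae_eq_of_hell_eq_zero hhell)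
  rw [e1, e2, ← e3]

end Map

section Limit

variable {α : Type*} [MeasurableSpace α] {ρ ρ' μ : Measure α}

theorem lintegral_two_mul_klFun_add (h : ρ ≪ μ) :
    ∫⁻ x, 2 * (ENNReal.ofReal (klFun (dens ρ μ x)) + 1) ∂μ = 2 * (KLdiv ρ μ + μ Set.univ) := by
  rw [lintegral_const_mul _ ((measurable_ofReal_klFun_dens ρ μ).add_const 1),
    lintegral_add_left (measurable_ofReal_klFun_dens ρ μ), lintegral_one, KLdiv_of_ac h]

theorem ofReal_le_two_mul_klFun_add {s : ℝ} (hs : 0 ≤ s) :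
    ENNReal.ofReal s ≤ 2 * (ENNReal.ofReal (klFun s) + 1) := by
  have h := InformationTheory.klFun_nonneg hs
  have e : ENNReal.ofReal (2 * (klFun s + 1)) = 2 * (ENNReal.ofReal (klFun s) + 1) := by
    rw [ofReal_mul zero_le_two, ofReal_add h zero_le_one, ofReal_one, ofReal_ofNat]
  rw [← e]
  exact ofReal_le_ofReal (le_two_mul_klFun_add hs)

theorem measure_univ_le_KLdiv [IsFiniteMeasure ρ] [IsFiniteMeasure μ] (h : ρ ≪ μ) :
    ρ Set.univ ≤ 2 * (KLdiv ρ μ + μ Set.univ) := by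
  conv_lhs => rw [← ofReal_dens_withDensity h]
  rw [withDensity_apply _ MeasurableSet.univ, setLIntegral_univ, ← lintegral_two_mul_klFun_add h]
  exact lintegral_mono fun x => ofReal_le_two_mul_klFun_add (dens_nonneg _ _ _)

theorem eLpNorm_dens_sub_le (h : ρ ≪ μ) (h' : ρ' ≪ μ) {η : ℝ} (hη : 0 < η) :
    eLpNorm (dens ρ μ - dens ρ' μ) 1 μ ≤ ENNReal.ofReal (2 * η⁻¹) * hell ρ ρ' μ +
      ENNReal.ofReal η * (2 * (KLdiv ρ μ + μ Set.univ) + 2 * (KLdiv ρ' μ + μ Set.univ)) := by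
  have m0 : Measurable fun x => ENNReal.ofReal ((√(dens ρ μ x) - √(dens ρ' μ x)) ^ 2 / 2) := by
    have := measurable_dens ρ μ
    have := measurable_dens ρ' μ
    fun_prop
  have m1 : Measurable fun x => 2 * (ENNReal.ofReal (klFun (dens ρ μ x)) + 1) :=
    ((measurable_ofReal_klFun_dens ρ μ).add_const 1).const_mul 2
  have m2 : Measurable fun x => 2 * (ENNReal.ofReal (klFun (dens ρ' μ x)) + 1) :=
    ((measurable_ofReal_klFun_dens ρ' μ).add_const 1).const_mul 2
  rw [← lintegral_two_mul_klFun_add h, ← lintegral_two_mul_klFun_add h', hell,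
    ← lintegral_const_mul _ m0, ← lintegral_add_left m1, ← lintegral_const_mul' _ _ ofReal_ne_top,
    ← lintegral_add_left (m0.const_mul _), eLpNorm_one_eq_lintegral_enorm]
  refine lintegral_mono fun x => ?_
  have a := dens_nonneg ρ μ x
  have b := dens_nonneg ρ' μ x
  calc ‖(dens ρ μ - dens ρ' μ) x‖ₑ = ENNReal.ofReal |dens ρ μ x - dens ρ' μ x| :=
        Real.enorm_eq_ofReal_abs _
    _ ≤ ENNReal.ofReal (2 * η⁻¹ * ((√(dens ρ μ x) - √(dens ρ' μ x)) ^ 2 / 2)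
        + η * (dens ρ μ x + dens ρ' μ x)) := by
      refine ofReal_le_ofReal ((abs_sub_le_hellinger a b hη).trans_eq ?_)
      ring
    _ = ENNReal.ofReal (2 * η⁻¹) * ENNReal.ofReal ((√(dens ρ μ x) - √(dens ρ' μ x)) ^ 2 / 2)
        + ENNReal.ofReal η * (ENNReal.ofReal (dens ρ μ x) + ENNReal.ofReal (dens ρ' μ x)) := by
      rw [ofReal_add (by positivity) (by positivity), ofReal_mul (by positivity),
        ofReal_mul hη.le, ofReal_add a b]
    _ ≤ _ := by
      gcongr
      · exact ofReal_le_two_mul_klFun_add a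
      · exact ofReal_le_two_mul_klFun_add b

theorem integral_withDensity_dens [IsFiniteMeasure ρ] [IsFiniteMeasure μ] (h : ρ ≪ μ)
    (φ : α → ℝ) : ∫ x, φ x ∂ρ = ∫ x, dens ρ μ x * φ x ∂μ := by
  conv_lhs => rw [← ofReal_dens_withDensity h]
  rw [integral_withDensity_eq_integral_toReal_smul (measurable_dens ρ μ).ennreal_ofReal
    (ae_of_all _ fun x => ofReal_lt_top)]
  simp only [toReal_ofReal (dens_nonneg ρ μ _), smul_eq_mul]

/-- A sequence of measures with rapidly Cauchy densities has a limit along which the entropy is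
lower semicontinuous. -/
theorem exists_limit_of_cauchy_dens [IsFiniteMeasure μ] {ρ : ℕ → Measure α}
    [∀ k, IsFiniteMeasure (ρ k)] (hac : ∀ k, ρ k ≪ μ) {B : ℕ → ℝ≥0∞} (hB : ∑' i, B i ≠ ⊤)
    (hc : ∀ N k j, N ≤ k → N ≤ j → eLpNorm (dens (ρ k) μ - dens (ρ j) μ) 1 μ < B N) :
    ∃ ρ' : Measure α, IsFiniteMeasure ρ' ∧ KLdiv ρ' μ ≤ liminf (fun k => KLdiv (ρ k) μ) atTop ∧
      ∀ φ : α → ℝ, Measurable φ → (∃ C, ∀ x, |φ x| ≤ C) →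
        Tendsto (fun k => ∫ x, φ x ∂(ρ k)) atTop (𝓝 (∫ x, φ x ∂ρ')) := by
  have hL : ∀ k, MemLp (dens (ρ k) μ) 1 μ := fun k =>
    memLp_one_iff_integrable.2 (integrable_dens (ρ k) μ)
  obtain ⟨f, hf, hlim⟩ := Lp.cauchy_complete_eLpNorm le_rfl hL hB hc
  have hsub : ∃ f' : α → ℝ, Measurable f' ∧ (∀ x, 0 ≤ f' x) ∧ f =ᵐ[μ] f' ∧
      ∀ᵐ x ∂μ, Tendsto (fun k => dens (ρ k) μ x) atTop (𝓝 (f' x)) := by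
    have hae := Lp.ae_tendsto_of_cauchy_eLpNorm (fun k => (hL k).1) le_rfl hB hc
    obtain ⟨g, hgm, hg⟩ := measurable_limit_of_tendsto_metrizable_ae
      (fun k => (measurable_dens (ρ k) μ).aemeasurable) hae
    have hg0 : ∀ᵐ x ∂μ, max (g x) 0 = g x := by
      filter_upwards [hg] with x hx
      exact max_eq_left (ge_of_tendsto' hx fun k => dens_nonneg _ _ _)
    have hfg : f =ᵐ[μ] g := by
      have hmeas := tendstoInMeasure_of_tendsto_eLpNorm one_ne_zero (fun k => (hL k).1) hf.1 hlim
      exact tendstoInMeasure_ae_unique hmeas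
        (tendstoInMeasure_of_tendsto_ae (fun k => (hL k).1) hg)
    refine ⟨fun x => max (g x) 0, hgm.max measurable_const, fun x => le_max_right _ _, ?_, ?_⟩
    · filter_upwards [hfg, hg0] with x h1 h2
      rw [h1, h2]
    · filter_upwards [hg, hg0] with x h1 h2
      rwa [h2]
  obtain ⟨f', hfm, hf0, hff, hae⟩ := hsub
  have hfi : Integrable f' μ := (memLp_one_iff_integrable.1 hf).congr hff
  set ρ' := μ.withDensity fun x => ENNReal.ofReal (f' x) with hρ'
  have hfin : IsFiniteMeasure ρ' := isFiniteMeasure_withDensity_ofReal hfi.2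
  have hdens : dens ρ' μ =ᵐ[μ] f' := by
    filter_upwards [Measure.rnDeriv_withDensity μ hfm.ennreal_ofReal] with x hx
    rw [dens, hx, toReal_ofReal (hf0 x)]
  have hac' : ρ' ≪ μ := withDensity_absolutelyContinuous _ _
  refine ⟨ρ', hfin, ?_, ?_⟩
  · rw [KLdiv_of_ac hac']
    simp only [fun k => KLdiv_of_ac (hac k)]
    refine le_trans (lintegral_mono_ae ?_)
      (lintegral_liminf_le fun k => measurable_ofReal_klFun_dens (ρ k) μ)
    filter_upwards [hdens, hae] with x h1 h2
    rw [h1]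
    exact ((ENNReal.continuous_ofReal.comp InformationTheory.continuous_klFun).tendsto _
      |>.comp h2).liminf_eq.ge
  · rintro φ hφ ⟨C, hC⟩
    simp only [fun k => integral_withDensity_dens (hac k) φ]
    rw [integral_withDensity_dens hac' φ, integral_congr_ae (g := fun x => f' x * φ x)
      (by filter_upwards [hdens] with x hx; rw [hx])]
    have hint (u : α → ℝ) (hu : Integrable u μ) : Integrable (fun x => u x * φ x) μ :=
      hu.mul_bdd hφ.aestronglyMeasurable (ae_of_all _ hC)
    refine tendsto_integral_of_L1 _ (hint f' hfi).1
      (Eventually.of_forall fun k => hint _ (integrable_dens (ρ k) μ)) ?_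
    have hz : Tendsto (fun k => ENNReal.ofReal C * eLpNorm (dens (ρ k) μ - f) 1 μ) atTop
        (𝓝 (ENNReal.ofReal C * 0)) := ENNReal.Tendsto.const_mul hlim (Or.inr ofReal_ne_top)
    rw [MulZeroClass.mul_zero] at hz
    refine tendsto_of_tendsto_of_tendsto_of_le_of_le tendsto_const_nhds hz
      (fun k => zero_le) fun k => ?_
    simp only
    rw [eLpNorm_one_eq_lintegral_enorm, ← lintegral_const_mul' _ _ ofReal_ne_top]
    refine lintegral_mono_ae ?_
    filter_upwards [hff] with x hx
    rw [← sub_mul, enorm_mul, mul_comm, Pi.sub_apply, hx]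
    gcongr
    rw [Real.enorm_eq_ofReal_abs]
    exact ofReal_le_ofReal (hC x)

end Limit

section Existence

variable {n : ℕ} {κ : ℝ} {μ0 μ1 : Measure (Eucl n)}

/-- A bounded continuous truncation of the cost. -/
noncomputable def truncCost (κ : ℝ) (M : ℕ) (p : Eucl n × Eucl n) : ℝ :=
  -2 * κ ^ 2 * Real.log (max (cosKer κ p.1 p.2) ((M : ℝ) + 1)⁻¹)

theorem continuous_truncCost (M : ℕ) :
    Continuous (truncCost κ M : Eucl n × Eucl n → ℝ) := by
  refine continuous_const.mul (Continuous.log (continuous_cosKer.max continuous_const) fun p => ?_)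
  exact (lt_of_lt_of_le (by positivity) (le_max_right _ _)).ne'

theorem truncCost_mem_Icc (M : ℕ) (p : Eucl n × Eucl n) :
    truncCost κ M p ∈ Set.Icc 0 (2 * κ ^ 2 * Real.log ((M : ℝ) + 1)) := by
  have h0 : (0 : ℝ) < ((M : ℝ) + 1)⁻¹ := by positivity
  have h1 : max (cosKer κ p.1 p.2) ((M : ℝ) + 1)⁻¹ ≤ 1 :=
    max_le (cosKer_le_one _ _) (inv_le_one_of_one_le₀ (by linarith [M.cast_nonneg (α := ℝ)]))
  have h2 := Real.log_le_log h0 (le_max_right (cosKer κ p.1 p.2) _)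
  have h3 := Real.log_nonpos (h0.le.trans (le_max_right (cosKer κ p.1 p.2) _)) h1
  rw [Real.log_inv] at h2
  have hk : 0 ≤ 2 * κ ^ 2 := by positivity
  constructor <;> simp only [truncCost]
  · nlinarith
  · nlinarith

theorem ofReal_truncCost_le (hκ : 0 < κ) (M : ℕ) (p : Eucl n × Eucl n) :
    ENNReal.ofReal (truncCost κ M p) ≤ cHK κ p.1 p.2 := by
  rw [cHK_eq hκ]
  split_ifs with h
  · refine ofReal_le_ofReal ?_
    have := Real.log_le_log h (le_max_left _ ((M : ℝ) + 1)⁻¹)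
    have hk : 0 ≤ 2 * κ ^ 2 := by positivity
    simp only [truncCost]
    nlinarith
  · exact le_top

theorem monotone_truncCost : Monotone fun (M : ℕ) (p : Eucl n × Eucl n) =>
    ENNReal.ofReal (truncCost κ M p) := by
  intro M M' h p
  refine ofReal_le_ofReal ?_
  have h1 : (M : ℝ) ≤ M' := by exact_mod_cast h
  have h2 : ((M' : ℝ) + 1)⁻¹ ≤ ((M : ℝ) + 1)⁻¹ := by gcongr
  have := Real.log_le_log (lt_of_lt_of_le (by positivity) (le_max_right _ _))
    (max_le_max_left (cosKer κ p.1 p.2) h2)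
  have hk : 0 ≤ 2 * κ ^ 2 := by positivity
  simp only [truncCost]
  nlinarith

theorem cHK_le_iSup_truncCost (hκ : 0 < κ) (p : Eucl n × Eucl n) :
    cHK κ p.1 p.2 ≤ ⨆ M, ENNReal.ofReal (truncCost κ M p) := by
  have t1 : Tendsto (fun j : ℕ => (j : ℝ) + 1) atTop atTop :=
    tendsto_atTop_add_const_right _ _ tendsto_natCast_atTop_atTop
  rw [cHK_eq hκ]
  split_ifs with h
  · have t2 : Tendsto (fun j : ℕ => ((j : ℝ) + 1)⁻¹) atTop (𝓝 0) := t1.inv_tendsto_atTop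
    obtain ⟨M, hM⟩ := (t2.eventually_le_const h).exists
    refine le_trans (le_of_eq ?_) (le_iSup _ M)
    rw [truncCost, max_eq_left hM]
  · have h0 : cosKer κ p.1 p.2 = 0 := le_antisymm (not_lt.1 h) (cosKer_nonneg _ _)
    have e (M : ℕ) : truncCost κ M p = 2 * κ ^ 2 * Real.log ((M : ℝ) + 1) := by
      rw [truncCost, h0, max_eq_right (by positivity), Real.log_inv]
      ring
    have t2 : Tendsto (fun M : ℕ => ENNReal.ofReal (truncCost κ M p)) atTop (𝓝 ⊤) := by
      simp only [e]
      exact ENNReal.tendsto_ofReal_atTop.comp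
        ((Real.tendsto_log_atTop.comp t1).const_mul_atTop (by positivity))
    exact le_of_tendsto' t2 fun M => le_iSup (fun M => ENNReal.ofReal (truncCost κ M p)) M

theorem lintegral_cHK_eq_iSup (hκ : 0 < κ) (π : Measure (Eucl n × Eucl n)) :
    ∫⁻ p, cHK κ p.1 p.2 ∂π = ⨆ M, ∫⁻ p, ENNReal.ofReal (truncCost κ M p) ∂π := by
  rw [← lintegral_iSup (fun M => (continuous_truncCost M).measurable.ennreal_ofReal)
    monotone_truncCost]
  refine lintegral_congr fun p => le_antisymm (cHK_le_iSup_truncCost hκ p) ?_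
  exact iSup_le fun M => ofReal_truncCost_le hκ M p

theorem lintegral_ofReal_truncCost (M : ℕ) (π : Measure (Eucl n × Eucl n)) [IsFiniteMeasure π] :
    ∫⁻ p, ENNReal.ofReal (truncCost κ M p) ∂π = ENNReal.ofReal (∫ p, truncCost κ M p ∂π) :=
  (ofReal_integral_eq_lintegral_ofReal (Integrable.of_mem_Icc _ _
    (continuous_truncCost M).measurable.aemeasurable (ae_of_all _ (truncCost_mem_Icc M)))
    (ae_of_all _ fun p => (truncCost_mem_Icc M p).1)).symm

theorem exists_minimizing_seq [IsFiniteMeasure μ0] [IsFiniteMeasure μ1] :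
    ∃ π : ℕ → Measure (Eucl n × Eucl n), (∀ k, IsFiniteMeasure (π k)) ∧
      ∀ k, HKfun κ (π k) μ0 μ1 ≤ HK2 κ μ0 μ1 + ENNReal.ofReal (4⁻¹ ^ k) := by
  have (k : ℕ) : ∃ π : Measure (Eucl n × Eucl n), IsFiniteMeasure π ∧
      HKfun κ π μ0 μ1 ≤ HK2 κ μ0 μ1 + ENNReal.ofReal (4⁻¹ ^ k) := by
    have h : HK2 κ μ0 μ1 < HK2 κ μ0 μ1 + ENNReal.ofReal (4⁻¹ ^ k) :=
      ENNReal.lt_add_right HK2_ne_top (by rw [Ne, ofReal_eq_zero, not_le]; positivity)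
    conv_lhs at h => rw [HK2]
    simp only [iInf_lt_iff] at h
    obtain ⟨π, hπ, hlt⟩ := h
    exact ⟨π, hπ, hlt.le⟩
  choose π h1 h2 using this
  exact ⟨π, h1, h2⟩

theorem hell_le_of_almost_minimal [IsFiniteMeasure μ0] [IsFiniteMeasure μ1]
    {π π' : Measure (Eucl n × Eucl n)} [IsFiniteMeasure π] [IsFiniteMeasure π'] {e : ℝ≥0∞}
    (h : HKfun κ π μ0 μ1 ≤ HK2 κ μ0 μ1 + e) (h' : HKfun κ π' μ0 μ1 ≤ HK2 κ μ0 μ1 + e) :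
    ENNReal.ofReal (κ ^ 2) * hell (π.map Prod.fst) (π'.map Prod.fst) μ0 ≤ 2 * e ∧
      ENNReal.ofReal (κ ^ 2) * hell (π.map Prod.snd) (π'.map Prod.snd) μ1 ≤ 2 * e := by
  have hm := HKfun_midpoint (κ := κ) (π := π) (π' := π') (μ0 := μ0) (μ1 := μ1)
  have hlow := HK2_le (κ := κ) (π := (2⁻¹ : NNReal) • π + (2⁻¹ : NNReal) • π') (μ0 := μ0)
    (μ1 := μ1)
  have ht : 2 * HK2 κ μ0 μ1 ≠ ⊤ := mul_ne_top ofNat_ne_top HK2_ne_top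
  have h1 : 2 * HK2 κ μ0 μ1 +
      (ENNReal.ofReal (κ ^ 2) * hell (π.map Prod.fst) (π'.map Prod.fst) μ0
      + ENNReal.ofReal (κ ^ 2) * hell (π.map Prod.snd) (π'.map Prod.snd) μ1)
      ≤ 2 * HK2 κ μ0 μ1 + 2 * e := by
    calc _ ≤ 2 * HKfun κ ((2⁻¹ : NNReal) • π + (2⁻¹ : NNReal) • π') μ0 μ1 + _ := by gcongr
      _ ≤ _ := by rw [← add_assoc]; exact hm
      _ ≤ _ := add_le_add h h'
      _ = _ := by ring
  have h2 := (ENNReal.add_le_add_iff_left ht).1 h1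
  exact ⟨le_self_add.trans h2, le_add_self.trans h2⟩

/-- The entropy of the marginals of almost minimizers is bounded. -/
theorem KLdiv_le_of_HKfun_le (hκ : 0 < κ) {π : Measure (Eucl n × Eucl n)} {C : ℝ≥0∞}
    (h : HKfun κ π μ0 μ1 ≤ C) :
    KLdiv (π.map Prod.fst) μ0 ≤ (ENNReal.ofReal (κ ^ 2))⁻¹ * C ∧
      KLdiv (π.map Prod.snd) μ1 ≤ (ENNReal.ofReal (κ ^ 2))⁻¹ * C := by
  have hc : ENNReal.ofReal (κ ^ 2) ≠ 0 := by
    rw [Ne, ofReal_eq_zero, not_le]; positivity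
  have aux {a : ℝ≥0∞} (ha : ENNReal.ofReal (κ ^ 2) * a ≤ C) :
      a ≤ (ENNReal.ofReal (κ ^ 2))⁻¹ * C := by
    rwa [← ENNReal.div_eq_inv_mul, ENNReal.le_div_iff_mul_le (Or.inl hc) (Or.inl ofReal_ne_top),
      mul_comm]
  exact ⟨aux ((le_add_self.trans le_self_add).trans h), aux (le_add_self.trans h)⟩

end Existence

section Minimizer

theorem exists_limit_of_hell_le {α : Type*} [MeasurableSpace α] {μ : Measure α} [IsFiniteMeasure μ]
    {ρ : ℕ → Measure α} [∀ k, IsFiniteMeasure (ρ k)] {D c : ℝ≥0∞} (hD : D ≠ ⊤) (hc0 : c ≠ ⊤)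
    (hKL : ∀ k, KLdiv (ρ k) μ ≤ D) (hh : ∀ N k j, N ≤ k → N ≤ j →
      hell (ρ k) (ρ j) μ ≤ c * ENNReal.ofReal (4⁻¹ ^ N)) :
    ∃ ρ' : Measure α, IsFiniteMeasure ρ' ∧ KLdiv ρ' μ ≤ liminf (fun k => KLdiv (ρ k) μ) atTop ∧
      ∀ φ : α → ℝ, Measurable φ → (∃ C, ∀ x, |φ x| ≤ C) →
        Tendsto (fun k => ∫ x, φ x ∂(ρ k)) atTop (𝓝 (∫ x, φ x ∂ρ')) := by
  have hac (k) : ρ k ≪ μ := ac_of_KLdiv_ne_top (ne_top_of_le_ne_top hD (hKL k))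
  set A : ℝ≥0∞ := 2 * c + (2 * (D + μ Set.univ) + 2 * (D + μ Set.univ)) with hA
  have hAt : A ≠ ⊤ := by finiteness
  refine exists_limit_of_cauchy_dens hac (B := fun N => ENNReal.ofReal (2⁻¹ ^ N) * (A + 1)) ?_ ?_
  · rw [ENNReal.tsum_mul_right]
    refine mul_ne_top ?_ (by finiteness)
    exact Summable.tsum_ofReal_ne_top
      (summable_geometric_of_lt_one (by norm_num) (by norm_num))
  · intro N k j hk hj
    have hη : (0 : ℝ) < 2⁻¹ ^ N := by positivity
    have e : ENNReal.ofReal (2 * ((2⁻¹ : ℝ) ^ N)⁻¹) * ENNReal.ofReal (4⁻¹ ^ N) =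
        2 * ENNReal.ofReal (2⁻¹ ^ N) := by
      rw [← ofReal_mul (by positivity), ← ofReal_ofNat 2, ← ofReal_mul zero_le_two]
      congr 1
      have : (4⁻¹ : ℝ) ^ N = 2⁻¹ ^ N * 2⁻¹ ^ N := by rw [← mul_pow]; norm_num
      rw [this]
      field_simp
    calc eLpNorm (dens (ρ k) μ - dens (ρ j) μ) 1 μ
        ≤ ENNReal.ofReal (2 * ((2⁻¹ : ℝ) ^ N)⁻¹) * hell (ρ k) (ρ j) μ +
          ENNReal.ofReal (2⁻¹ ^ N) *
            (2 * (KLdiv (ρ k) μ + μ Set.univ) + 2 * (KLdiv (ρ j) μ + μ Set.univ)) :=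
          eLpNorm_dens_sub_le (hac k) (hac j) hη
      _ ≤ ENNReal.ofReal (2 * ((2⁻¹ : ℝ) ^ N)⁻¹) * (c * ENNReal.ofReal (4⁻¹ ^ N)) +
          ENNReal.ofReal (2⁻¹ ^ N) * (2 * (D + μ Set.univ) + 2 * (D + μ Set.univ)) := by
        gcongr
        · exact hh N k j hk hj
        · exact hKL k
        · exact hKL j
      _ = ENNReal.ofReal (2⁻¹ ^ N) * A := by
        rw [mul_left_comm, e, hA]
        ring
      _ < ENNReal.ofReal (2⁻¹ ^ N) * (A + 1) := by
        refine (ENNReal.mul_lt_mul_iff_right ?_ ofReal_ne_top).2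
          (ENNReal.lt_add_right hAt one_ne_zero)
        rw [Ne, ofReal_eq_zero, not_le]
        exact hη

/-- Finite measures concentrated on a common compact set and of bounded mass have a weak limit
point along any ultrafilter. -/
theorem exists_ultrafilter_limit {E : Type*} [MeasurableSpace E] [TopologicalSpace E] [T2Space E]
    [NormalSpace E] [BorelSpace E] {π : ℕ → Measure E} [∀ k, IsFiniteMeasure (π k)] {C : ℝ≥0∞}
    (hC : C ≠ ⊤) (hm : ∀ k, π k Set.univ ≤ C) {K : Set E} (hK : IsCompact K)
    (hKπ : ∀ k, π k Kᶜ = 0) (U : Ultrafilter ℕ) :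
    ∃ π' : Measure E, IsFiniteMeasure π' ∧ ∀ φ : BoundedContinuousFunction E ℝ,
      Tendsto (fun k => ∫ x, φ x ∂(π k)) U (𝓝 (∫ x, φ x ∂π')) := by
  set P : ℕ → FiniteMeasure E := fun k => ⟨π k, inferInstance⟩ with hP
  have hcpt := isCompact_setOfPred_finiteMeasure_le_of_isCompact C.toNNReal hK
  have hmem (k) : P k ∈ {μ : FiniteMeasure E | μ.mass ≤ C.toNNReal ∧ μ Kᶜ = 0} := by
    refine ⟨?_, ?_⟩
    · exact ENNReal.toNNReal_mono hC (hm k)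
    · rw [FiniteMeasure.null_iff_toMeasure_null]
      exact hKπ k
  obtain ⟨Q, -, hQ⟩ := hcpt.ultrafilter_le_nhds (U.map P) (by
    rw [le_principal_iff]
    exact Ultrafilter.mem_map.2 (univ_mem' hmem))
  exact ⟨Q, inferInstance, fun φ =>
    FiniteMeasure.tendsto_iff_forall_integral_tendsto.1 (show Tendsto P U (𝓝 Q) from hQ) φ⟩

variable {n : ℕ} {κ : ℝ} {μ0 μ1 : Measure (Eucl n)}

/-- The soft-marginal problem between compactly supported measures has a minimizer. -/
theorem exists_minimizer (hκ : 0 < κ) [IsFiniteMeasure μ0] [IsFiniteMeasure μ1]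
    (hμ0K : ∃ K : Set (Eucl n), IsCompact K ∧ μ0 Kᶜ = 0)
    (hμ1K : ∃ K : Set (Eucl n), IsCompact K ∧ μ1 Kᶜ = 0) :
    ∃ π : Measure (Eucl n × Eucl n), IsFiniteMeasure π ∧ HKfun κ π μ0 μ1 = HK2 κ μ0 μ1 := by
  obtain ⟨K0, hK0, hK0'⟩ := hμ0K
  obtain ⟨K1, hK1, hK1'⟩ := hμ1K
  obtain ⟨π, hfin, hπ⟩ := exists_minimizing_seq (κ := κ) (μ0 := μ0) (μ1 := μ1)
  have hc : ENNReal.ofReal (κ ^ 2) ≠ 0 := by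
    rw [Ne, ofReal_eq_zero, not_le]; positivity
  have hci : (ENNReal.ofReal (κ ^ 2))⁻¹ ≠ ⊤ := inv_ne_top.2 hc
  set D : ℝ≥0∞ := (ENNReal.ofReal (κ ^ 2))⁻¹ * (HK2 κ μ0 μ1 + 1) with hD
  have hDt : D ≠ ⊤ := mul_ne_top hci (add_ne_top.2 ⟨HK2_ne_top, one_ne_top⟩)
  have hpow (k : ℕ) : ENNReal.ofReal (4⁻¹ ^ k) ≤ 1 := by
    rw [← ofReal_one]
    exact ofReal_le_ofReal (pow_le_one₀ (by norm_num) (by norm_num))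
  have hKL (k) := KLdiv_le_of_HKfun_le hκ ((hπ k).trans (add_le_add_right (hpow k) _))
  have hac0 (k) : (π k).map Prod.fst ≪ μ0 :=
    ac_of_KLdiv_ne_top (ne_top_of_le_ne_top hDt (hKL k).1)
  have hac1 (k) : (π k).map Prod.snd ≪ μ1 :=
    ac_of_KLdiv_ne_top (ne_top_of_le_ne_top hDt (hKL k).2)
  have hhell (N k j : ℕ) (hk : N ≤ k) (hj : N ≤ j) := by
    have mono {i} (hi : N ≤ i) : ENNReal.ofReal (4⁻¹ ^ i) ≤ ENNReal.ofReal (4⁻¹ ^ N) :=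
      ofReal_le_ofReal (pow_le_pow_of_le_one (by norm_num) (by norm_num) hi)
    exact hell_le_of_almost_minimal ((hπ k).trans (add_le_add_right (mono hk) _))
      ((hπ j).trans (add_le_add_right (mono hj) _))
  have hdiv {a : ℝ≥0∞} {N : ℕ} (h : ENNReal.ofReal (κ ^ 2) * a ≤ 2 * ENNReal.ofReal (4⁻¹ ^ N)) :
      a ≤ (ENNReal.ofReal (κ ^ 2))⁻¹ * 2 * ENNReal.ofReal (4⁻¹ ^ N) := by
    rw [mul_assoc]
    rwa [← ENNReal.div_eq_inv_mul, ENNReal.le_div_iff_mul_le (Or.inl hc) (Or.inl ofReal_ne_top),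
      mul_comm]
  have hct : (ENNReal.ofReal (κ ^ 2))⁻¹ * 2 ≠ ⊤ := mul_ne_top hci ofNat_ne_top
  obtain ⟨ρ0, hρ0, hl0, ht0⟩ := exists_limit_of_hell_le (ρ := fun k => (π k).map Prod.fst) hDt hct
    (fun k => (hKL k).1) fun N k j hk hj => hdiv (hhell N k j hk hj).1
  obtain ⟨ρ1, hρ1, hl1, ht1⟩ := exists_limit_of_hell_le (ρ := fun k => (π k).map Prod.snd) hDt hct
    (fun k => (hKL k).2) fun N k j hk hj => hdiv (hhell N k j hk hj).2
  set U : Ultrafilter ℕ := hyperfilter ℕ with hU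
  have hUle : (U : Filter ℕ) ≤ atTop := Nat.hyperfilter_le_atTop
  have hmass (k) : π k Set.univ ≤ 2 * (D + μ0 Set.univ) := by
    have h := measure_univ_le_KLdiv (hac0 k)
    rw [Measure.map_apply measurable_fst MeasurableSet.univ, Set.preimage_univ] at h
    refine h.trans ?_
    gcongr
    exact (hKL k).1
  have hcompl (k) : π k (K0 ×ˢ K1)ᶜ = 0 := by
    rw [Set.compl_prod_eq_union]
    refine measure_union_null ?_ ?_
    · have := hac0 k hK0'
      rw [Measure.map_apply measurable_fst hK0.measurableSet.compl] at this
      rwa [Set.prod_univ]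
    · have := hac1 k hK1'
      rw [Measure.map_apply measurable_snd hK1.measurableSet.compl] at this
      rwa [Set.univ_prod]
  obtain ⟨π', hπ', hlim⟩ := exists_ultrafilter_limit (C := 2 * (D + μ0 Set.univ)) (by finiteness)
    hmass (hK0.prod hK1) hcompl U
  have hmarg (f : Eucl n × Eucl n → Eucl n) (hf : Continuous f) (ρ : Measure (Eucl n))
      [IsFiniteMeasure ρ] (ht : ∀ φ : Eucl n → ℝ, Measurable φ → (∃ C, ∀ x, |φ x| ≤ C) →
        Tendsto (fun k => ∫ x, φ x ∂((π k).map f)) atTop (𝓝 (∫ x, φ x ∂ρ))) : π'.map f = ρ := by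
    refine ext_of_forall_integral_eq_of_IsFiniteMeasure fun φ => ?_
    refine tendsto_nhds_unique ?_
      ((ht φ φ.continuous.measurable ⟨‖φ‖, fun x => φ.norm_coe_le_norm x⟩).mono_left hUle)
    have := hlim (φ.compContinuous ⟨f, hf⟩)
    simp only [integral_map hf.measurable.aemeasurable φ.continuous.aestronglyMeasurable]
    exact this
  have hm0 := hmarg _ continuous_fst ρ0 ht0
  have hm1 := hmarg _ continuous_snd ρ1 ht1
  have hlimU (a : ℕ → ℝ≥0∞) : ∃ L, Tendsto a U (𝓝 L) ∧ liminf a atTop ≤ L := by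
    obtain ⟨L, -, hL⟩ := isCompact_univ.ultrafilter_le_nhds (U.map a) (by simp)
    have hL' : Tendsto a U (𝓝 L) := hL
    exact ⟨L, hL', (liminf_le_liminf_of_le hUle).trans_eq hL'.liminf_eq⟩
  obtain ⟨L0, hL0, hle0⟩ := hlimU fun k => KLdiv ((π k).map Prod.fst) μ0
  obtain ⟨L1, hL1, hle1⟩ := hlimU fun k => KLdiv ((π k).map Prod.snd) μ1
  refine ⟨π', hπ', le_antisymm ?_ HK2_le⟩
  rw [HKfun, hm0, hm1, lintegral_cHK_eq_iSup hκ, ENNReal.iSup_add, ENNReal.iSup_add]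
  refine iSup_le fun M => ?_
  have hcost : Tendsto (fun k => ∫⁻ p, ENNReal.ofReal (truncCost κ M p) ∂(π k)) U
      (𝓝 (∫⁻ p, ENNReal.ofReal (truncCost κ M p) ∂π')) := by
    simp only [fun k => lintegral_ofReal_truncCost (κ := κ) M (π k)]
    rw [lintegral_ofReal_truncCost]
    refine (ENNReal.continuous_ofReal.tendsto _).comp ?_
    refine hlim (BoundedContinuousFunction.ofNormedAddCommGroup (truncCost κ M)
      (continuous_truncCost M) (2 * κ ^ 2 * Real.log ((M : ℝ) + 1)) fun p => ?_)
    have := truncCost_mem_Icc (κ := κ) M p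
    rw [Real.norm_of_nonneg this.1]
    exact this.2
  have hsum := (hcost.add (ENNReal.Tendsto.const_mul (a := ENNReal.ofReal (κ ^ 2)) hL0
    (Or.inr ofReal_ne_top))).add (ENNReal.Tendsto.const_mul (a := ENNReal.ofReal (κ ^ 2)) hL1
    (Or.inr ofReal_ne_top))
  have hup : Tendsto (fun k : ℕ => HK2 κ μ0 μ1 + ENNReal.ofReal (4⁻¹ ^ k)) U
      (𝓝 (HK2 κ μ0 μ1)) := by
    have h1 : Tendsto (fun k : ℕ => ENNReal.ofReal ((4⁻¹ : ℝ) ^ k)) atTop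
        (𝓝 (ENNReal.ofReal 0)) :=
      (ENNReal.continuous_ofReal.tendsto _).comp
        (tendsto_pow_atTop_nhds_zero_of_lt_one (by norm_num) (by norm_num))
    have h2 := (h1.const_add (HK2 κ μ0 μ1)).mono_left hUle
    simpa using h2
  refine le_trans ?_ (le_of_tendsto_of_tendsto' hsum hup fun k => le_trans ?_ (hπ k))
  · gcongr
    · exact hl0.trans hle0
    · exact hl1.trans hle1
  · rw [HKfun]
    gcongr with p
    exact ofReal_truncCost_le hκ M p

end Minimizer

end

/-- existence and uniqueness of the minimizer of the soft-marginal HK problem,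
and the fact that it is induced by a Borel transport map. -/
theorem hk_optimal_transport_map_existence
    {n : ℕ} (hn : 1 ≤ n) (κ : ℝ) (hκ : 0 < κ)
    (μ0 μ1 : Measure (Eucl n)) [IsFiniteMeasure μ0] [IsFiniteMeasure μ1]
    (hμ0K : ∃ K : Set (Eucl n), IsCompact K ∧ μ0 Kᶜ = 0)
    (hμ1K : ∃ K : Set (Eucl n), IsCompact K ∧ μ1 Kᶜ = 0)
    (hμ0ac : μ0 ≪ (volume : Measure (Eucl n))) :
    ∃ π : Measure (Eucl n × Eucl n), IsFiniteMeasure π ∧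
      HKfun κ π μ0 μ1 = HK2 κ μ0 μ1 ∧
      (∀ π' : Measure (Eucl n × Eucl n), IsFiniteMeasure π' →
        HKfun κ π' μ0 μ1 = HK2 κ μ0 μ1 → π' = π) ∧
      ∃ T : Eucl n → Eucl n, Measurable T ∧
        π = (π.map Prod.fst).map (fun x => (x, T x)) := by
  obtain ⟨π, hπ, hmin⟩ := exists_minimizer hκ hμ0K hμ1K
  obtain ⟨G, hG, huniq⟩ := exists_graph hκ hμ0ac hmin
  obtain ⟨T, hT, hTG⟩ := exists_map_of_graph hG huniq
  exact ⟨π, hπ, hmin, fun π' hπ' h' => minimizer_unique hκ hμ0ac hmin h', T, hT,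
    eq_map_of_ae_eq hT hTG⟩
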